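/- Suppose (q_n)_{n≥1} is a sequence of positive reals such that lim_{n→∞} n(1−q_n) = β ∈ ℝ. Then for each ε > 0, μ_{n,q_n}({π ∈ S_n : n^{−1/2} ℓ(π) ∈ (2e^{−|β|/2} − ε, 2e^{|β|/2} + ε)}) → 1 as n → ∞. -/

import Mathlib

open Filter

/-- Number of inversions of a permutation of `Fin n`. -/
def inversions {n : ℕ} (π : Equiv.Perm (Fin n)) : ℕ :=
  (Finset.univ.filter (fun p : Fin n × Fin n => p.1 < p.2 ∧ π p.2 < π p.1)).card

/-- Length of the longest increasing subsequence of a permutation of `Fin n`. -/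
def lisLength {n : ℕ} (π : Equiv.Perm (Fin n)) : ℕ :=
  Finset.univ.powerset.sup fun s : Finset (Fin n) =>
    if ∀ i ∈ s, ∀ j ∈ s, i < j → π i < π j then s.card else 0

/-- The Mallows(n,q) probability of a set of permutations. -/
noncomputable def mallowsProb (n : ℕ) (q : ℝ) (A : Set (Equiv.Perm (Fin n))) : ℝ :=
  (∑ π : Equiv.Perm (Fin n), A.indicator (fun π => q ^ inversions π) π) /
    (∑ π : Equiv.Perm (Fin n), q ^ inversions π)

/-! ### Finite expectation functionals -/

/-- A positive normalised linear functional on real functions. -/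
structure Ex (α : Type) where
  toFun : (α → ℝ) → ℝ
  add' : ∀ f g : α → ℝ, toFun (fun a => f a + g a) = toFun f + toFun g
  smul' : ∀ (c : ℝ) (f : α → ℝ), toFun (fun a => c * f a) = c * toFun f
  mono' : ∀ f g : α → ℝ, (∀ a, f a ≤ g a) → toFun f ≤ toFun g
  one' : toFun (fun _ => 1) = 1

namespace Ex

variable {α β : Type}

theorem const (E : Ex α) (c : ℝ) : E.toFun (fun _ => c) = c := by
  have := E.smul' c (fun _ => 1)
  simpa [E.one'] using this

/-- Point mass. -/
def dirac (a : α) : Ex α where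
  toFun f := f a
  add' _ _ := rfl
  smul' _ _ := rfl
  mono' _ _ h := h a
  one' := rfl

/-- Bernoulli expectation. -/
def ber (p : ℝ) (h0 : 0 ≤ p) (h1 : p ≤ 1) : Ex Bool where
  toFun f := p * f true + (1 - p) * f false
  add' _ _ := by ring
  smul' _ _ := by ring
  mono' f g h := by
    have := mul_le_mul_of_nonneg_left (h true) h0
    have := mul_le_mul_of_nonneg_left (h false) (sub_nonneg.2 h1)
    linarith
  one' := by ring

/-- Four valued expectation with thresholds `a3 ≤ a2 ≤ a1`. -/
def four (a1 a2 a3 : ℝ) (h0 : 0 ≤ a3) (h1 : a3 ≤ a2) (h2 : a2 ≤ a1) (h3 : a1 ≤ 1) :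
    Ex (Fin 4) where
  toFun f := (1 - a1) * f 0 + (a1 - a2) * f 1 + (a2 - a3) * f 2 + a3 * f 3
  add' _ _ := by ring
  smul' _ _ := by ring
  mono' f g h := by
    have := mul_le_mul_of_nonneg_left (h 0) (sub_nonneg.2 h3)
    have := mul_le_mul_of_nonneg_left (h 1) (sub_nonneg.2 h2)
    have := mul_le_mul_of_nonneg_left (h 2) (sub_nonneg.2 h1)
    have := mul_le_mul_of_nonneg_left (h 3) h0
    linarith
  one' := by ring

/-- Product functional. -/
def prod (E : Ex α) (E' : Ex β) : Ex (α × β) where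
  toFun f := E.toFun fun a => E'.toFun fun b => f (a, b)
  add' f g := by simp only [E'.add', E.add']
  smul' c f := by simp only [E'.smul', E.smul']
  mono' f g h := E.mono' _ _ fun a => E'.mono' _ _ fun b => h _
  one' := by simp only [E'.one', E.one']

def iid (E : Ex α) (d : α) : ℕ → Ex (ℕ → α)
  | 0 => dirac fun _ => d
  | n + 1 =>
    { toFun := fun f => (iid E d n).toFun fun x => E.toFun fun a => f (Function.update x n a)
      add' := fun f g => by simp only [E.add', (iid E d n).add']
      smul' := fun c f => by simp only [E.smul', (iid E d n).smul']
      mono' := fun f g h => (iid E d n).mono' _ _ fun x => E.mono' _ _ fun a => h _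
      one' := by simp only [E.one', (iid E d n).one'] }

theorem iid_zero (E : Ex α) (d : α) (f : (ℕ → α) → ℝ) :
    (iid E d 0).toFun f = f fun _ => d := rfl

theorem iid_succ (E : Ex α) (d : α) (n : ℕ) (f : (ℕ → α) → ℝ) :
    (iid E d (n + 1)).toFun f =
      (iid E d n).toFun fun x => E.toFun fun a => f (Function.update x n a) := rfl

theorem ber_apply (p : ℝ) (h0 : 0 ≤ p) (h1 : p ≤ 1) (f : Bool → ℝ) :
    (ber p h0 h1).toFun f = p * f true + (1 - p) * f false := rfl

theorem prod_apply (E : Ex α) (E' : Ex β) (f : α × β → ℝ) :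
    (prod E E').toFun f = E.toFun fun a => E'.toFun fun b => f (a, b) := rfl

theorem ber_swap (p : ℝ) (h0 : 0 ≤ p) (h1 : p ≤ 1) (E : Ex β) (f : Bool → β → ℝ) :
    (ber p h0 h1).toFun (fun b => E.toFun (f b)) =
      E.toFun fun x => (ber p h0 h1).toFun fun b => f b x := by
  simp only [ber_apply, E.add', E.smul']

theorem iid_map (E : Ex α) (E' : Ex β) (d : α) (g : α → β)
    (h : ∀ f : β → ℝ, E.toFun (fun a => f (g a)) = E'.toFun f) (n : ℕ) :
    ∀ f : (ℕ → β) → ℝ,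
      (iid E d n).toFun (fun x => f fun i => g (x i)) = (iid E' (g d) n).toFun f := by
  induction n with
  | zero => intro f; rfl
  | succ n ih =>
    intro f
    rw [iid_succ, iid_succ, ← ih]
    congr 1; funext x
    rw [← h]
    congr 1; funext a
    congr 1; funext i
    by_cases hi : i = n
    · subst hi; simp
    · simp [Function.update_of_ne hi]

/-- Pair marginal. -/
theorem prod_snd (E : Ex α) (E' : Ex β) (f : β → ℝ) :
    (prod E E').toFun (fun x => f x.2) = E'.toFun f := by
  rw [prod_apply]; exact E.const (E'.toFun f)

theorem prod_fst (E : Ex α) (E' : Ex β) (f : α → ℝ) :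
    (prod E E').toFun (fun x => f x.1) = E.toFun f := by
  rw [prod_apply]; congr 1; funext a; exact E'.const (f a)

/-- number of `true` among the first `m` -/
def cnt (m : ℕ) (x : ℕ → Bool) : ℤ := ∑ i ∈ Finset.range m, if x i then 1 else 0

theorem cnt_succ (m : ℕ) (x : ℕ → Bool) :
    cnt (m + 1) x = cnt m x + if x m then 1 else 0 := by
  unfold cnt; rw [Finset.sum_range_succ]

theorem cnt_congr (m : ℕ) (x y : ℕ → Bool) (h : ∀ i < m, x i = y i) : cnt m x = cnt m y := by
  unfold cnt
  apply Finset.sum_congr rfl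
  intro i hi
  rw [h i (Finset.mem_range.1 hi)]

theorem variance_cnt (a : ℝ) (h0 : 0 ≤ a) (h1 : a ≤ 1) (m : ℕ) :
    (iid (ber a h0 h1) false m).toFun (fun x => ((cnt m x : ℝ) - a * m) ^ 2) =
      m * (a * (1 - a)) := by
  induction m with
  | zero => simp [iid_zero, cnt]
  | succ m ih =>
    rw [iid_succ]
    have : ∀ x : ℕ → Bool, (ber a h0 h1).toFun (fun b =>
        ((cnt (m + 1) (Function.update x m b) : ℝ) - a * ((m + 1 : ℕ) : ℝ)) ^ 2) =
        ((cnt m x : ℝ) - a * m) ^ 2 + a * (1 - a) := by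
      intro x
      have hc : ∀ b, cnt m (Function.update x m b) = cnt m x := fun b =>
        cnt_congr _ _ _ fun i hi => Function.update_of_ne hi.ne _ _
      simp only [ber_apply, cnt_succ, hc, Function.update_self]
      push_cast
      simp
      ring
    simp only [this]
    rw [Ex.add', ih, Ex.const]
    push_cast; ring

/-- expectations of initial segments -/
theorem iid_initial (E : Ex α) (d : α) (m k : ℕ) (f : (ℕ → α) → ℝ)
    (hf : ∀ x y : ℕ → α, (∀ i < m, x i = y i) → f x = f y) :
    (iid E d (m + k)).toFun f = (iid E d m).toFun f := by
  induction k with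
  | zero => rfl
  | succ k ih =>
    rw [← add_assoc, iid_succ, ← ih]
    congr 1; funext x
    have : (fun a => f (Function.update x (m + k) a)) = fun _ => f x := by
      funext a
      apply hf
      intro i hi
      exact Function.update_of_ne (by omega) _ _
    rw [this, E.const]

open Classical in
/-- Probability of an event. -/
noncomputable def pr (E : Ex α) (A : α → Prop) : ℝ := E.toFun fun a => if A a then 1 else 0

theorem pr_mono (E : Ex α) (A B : α → Prop) (h : ∀ a, A a → B a) : E.pr A ≤ E.pr B := by
  apply E.mono'
  intro a
  by_cases hA : A a
  · simp [hA, h a hA]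
  · simp only [hA, if_false]; split_ifs <;> norm_num

theorem pr_or (E : Ex α) (A B : α → Prop) : E.pr (fun a => A a ∨ B a) ≤ E.pr A + E.pr B := by
  unfold pr
  rw [← E.add']
  apply E.mono'
  intro a
  by_cases hA : A a <;> by_cases hB : B a <;> simp [hA, hB]

theorem pr_not (E : Ex α) (A : α → Prop) : E.pr (fun a => ¬ A a) = 1 - E.pr A := by
  have h : E.pr (fun a => ¬ A a) + E.pr A = 1 := by
    unfold pr
    rw [← E.add']
    refine Eq.trans ?_ E.one'
    congr 1
    funext a
    by_cases hA : A a <;> simp [hA]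
  linarith

theorem pr_nonneg (E : Ex α) (A : α → Prop) : 0 ≤ E.pr A := by
  rw [← E.const 0]
  apply E.mono'
  intro a; split_ifs <;> norm_num

/-- Chebyshev for the first `k` of `m` Bernoulli variables. -/
theorem chebyshev (a : ℝ) (h0 : 0 ≤ a) (h1 : a ≤ 1) (m k : ℕ) (hk : k ≤ m) (t : ℝ) (ht : 0 < t) :
    (iid (ber a h0 h1) false m).pr (fun x => t ≤ |(cnt k x : ℝ) - a * k|) ≤ a * k / t ^ 2 := by
  obtain ⟨l, rfl⟩ := Nat.exists_eq_add_of_le hk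
  have hv := variance_cnt a h0 h1 k
  rw [← iid_initial _ _ k l] at hv
  · calc _ ≤ (iid (ber a h0 h1) false (k + l)).toFun
          (fun x => (1 / t ^ 2) * ((cnt k x : ℝ) - a * k) ^ 2) := by
          apply Ex.mono'
          intro x
          split_ifs with h
          · have : t ^ 2 ≤ ((cnt k x : ℝ) - a * k) ^ 2 := by
              rw [← sq_abs ((cnt k x : ℝ) - a * k)]
              exact pow_le_pow_left₀ ht.le h 2
            rw [one_div, ← div_eq_inv_mul, le_div_iff₀ (by positivity)]
            linarith
          · positivity
      _ = (1 / t ^ 2) * (k * (a * (1 - a))) := by rw [Ex.smul', hv]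
      _ ≤ _ := by
          rw [one_div, ← div_eq_inv_mul]
          apply div_le_div_of_nonneg_right _ (by positivity)
          have : (0:ℝ) ≤ k * a * a := by positivity
          nlinarith
  · intro x y h
    rw [cnt_congr k x y h]

end Ex

/-! ### Last passage recursion and the Burke property -/

/-- 0/1 value of a Boolean. -/
def bz (b : Bool) : ℤ := if b then 1 else 0

/-- Last passage values with lower boundary `f` and left boundary `g`; `ξ j i` is the cell in
column `i` and row `j`. -/
def lpp (ξ : ℕ → ℕ → Bool) (f g : ℕ → ℤ) : ℕ → ℕ → ℤ
  | i, 0 => f i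
  | 0, j + 1 => g (j + 1)
  | i + 1, j + 1 =>
    max (max (lpp ξ f g i (j + 1)) (lpp ξ f g (i + 1) j)) (lpp ξ f g i j + bz (ξ j i))

theorem lpp_zero_right (ξ : ℕ → ℕ → Bool) (f g : ℕ → ℤ) (i : ℕ) : lpp ξ f g i 0 = f i := by
  cases i <;> simp [lpp]

theorem lpp_zero_left (ξ : ℕ → ℕ → Bool) (f g : ℕ → ℤ) (j : ℕ) :
    lpp ξ f g 0 (j + 1) = g (j + 1) := by
  simp [lpp]

theorem lpp_succ (ξ : ℕ → ℕ → Bool) (f g : ℕ → ℤ) (i j : ℕ) :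
    lpp ξ f g (i + 1) (j + 1) =
    max (max (lpp ξ f g i (j + 1)) (lpp ξ f g (i + 1) j)) (lpp ξ f g i j + bz (ξ j i)) := by
  rw [lpp]

theorem lpp_mono (ξ ξ' : ℕ → ℕ → Bool) (f g f' g' : ℕ → ℤ) (hξ : ∀ i j, bz (ξ j i) ≤ bz (ξ' j i))
    (hf : ∀ i, f i ≤ f' i) (hg : ∀ i, g i ≤ g' i) (i j : ℕ) :
    lpp ξ f g i j ≤ lpp ξ' f' g' i j := by
  induction j generalizing i with
  | zero => simp only [lpp_zero_right]; exact hf i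
  | succ j ihj =>
    induction i with
    | zero => simp only [lpp_zero_left]; exact hg _
    | succ i ihi =>
      rw [lpp_succ, lpp_succ]
      have := ihj i
      have := ihj (i + 1)
      have := hξ i j
      omega

theorem lpp_shift (ξ : ℕ → ℕ → Bool) (f g : ℕ → ℤ) (c : ℤ) (i j : ℕ) :
    lpp ξ (fun i => f i + c) (fun i => g i + c) i j = lpp ξ f g i j + c := by
  induction j generalizing i with
  | zero => simp only [lpp_zero_right]
  | succ j ihj =>
    induction i with
    | zero => simp only [lpp_zero_left]
    | succ i ihi =>
      rw [lpp_succ, lpp_succ, ihi, ihj, ihj]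
      omega

theorem lpp_max (ξ : ℕ → ℕ → Bool) (f g f' g' : ℕ → ℤ) (i j : ℕ) :
    lpp ξ (fun i => max (f i) (f' i)) (fun i => max (g i) (g' i)) i j =
      max (lpp ξ f g i j) (lpp ξ f' g' i j) := by
  induction j generalizing i with
  | zero => simp only [lpp_zero_right]
  | succ j ihj =>
    induction i with
    | zero => simp only [lpp_zero_left]
    | succ i ihi =>
      rw [lpp_succ, lpp_succ, lpp_succ, ihi, ihj, ihj]
      omega

/-- point-to-point last passage time -/
def lis0 (ξ : ℕ → ℕ → Bool) (i j : ℕ) : ℤ := lpp ξ (fun _ => 0) (fun _ => 0) i j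

open Ex in
theorem cnt_mono_right (x : ℕ → Bool) {m n : ℕ} (h : m ≤ n) : cnt m x ≤ cnt n x := by
  induction n, h using Nat.le_induction with
  | base => exact le_rfl
  | succ n hn ih => rw [cnt_succ]; split_ifs <;> omega

open Ex in
theorem cnt_nonneg (x : ℕ → Bool) (m : ℕ) : 0 ≤ cnt m x := by
  simp [cnt]

open Ex in
theorem lis0_le (ξ : ℕ → ℕ → Bool) (s t : ℕ → Bool) (i j : ℕ) :
    lis0 ξ i j ≤ lpp ξ (fun i => cnt i s) (fun j => cnt j t) i j :=
  lpp_mono _ _ _ _ _ _ (fun _ _ => le_rfl) (fun _ => cnt_nonneg _ _) (fun _ => cnt_nonneg _ _) _ _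

open Ex in
theorem cnt_diff (s s' : ℕ → Bool) (h : ∀ i, bz (s i) ≤ bz (s' i)) {m n : ℕ} (hmn : m ≤ n) :
    cnt m s' - cnt m s ≤ cnt n s' - cnt n s := by
  induction n, hmn using Nat.le_induction with
  | base => exact le_rfl
  | succ n hn ih =>
    rw [cnt_succ, cnt_succ]
    have := h n
    simp only [bz] at this
    omega

open Ex in
/-- The key deterministic inequality. -/
theorem key_det (ξ : ℕ → ℕ → Bool) (s t s1 t1 s2 t2 : ℕ → Bool) (k : ℕ)
    (hs : ∀ i, bz (s i) ≤ bz (s1 i)) (ht : ∀ i, bz (t i) ≤ bz (t2 i)) (i j : ℕ) :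
    lpp ξ (fun i => cnt i s) (fun j => cnt j t) i j ≤
      max (lis0 ξ i j + max (cnt k s) (cnt k t))
        (max (lpp ξ (fun i => cnt i s1) (fun j => cnt j t1) i j - (cnt k s1 - cnt k s))
          (lpp ξ (fun i => cnt i s2) (fun j => cnt j t2) i j - (cnt k t2 - cnt k t))) := by
  obtain ⟨D1, hD1⟩ : ∃ D, D = -(cnt k s1 - cnt k s) := ⟨_, rfl⟩
  obtain ⟨D2, hD2⟩ : ∃ D, D = -(cnt k t2 - cnt k t) := ⟨_, rfl⟩
  rw [sub_eq_add_neg (lpp _ _ _ _ _), sub_eq_add_neg (lpp _ _ _ _ _), ← hD1, ← hD2, lis0,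
    ← lpp_shift, ← lpp_shift, ← lpp_shift, ← lpp_max, ← lpp_max]
  apply lpp_mono
  · intro _ _; exact le_rfl
  · intro i
    rcases le_total i k with h | h
    · have := cnt_mono_right s h
      omega
    · have := cnt_diff s s1 hs h
      omega
  · intro i
    rcases le_total i k with h | h
    · have := cnt_mono_right t h
      omega
    · have := cnt_diff t t2 ht h
      omega

/-! Burke -/

/-- horizontal output -/
def hout (h v x : Bool) : Bool := !v && (h || x)
/-- vertical output -/
def vout (h v x : Bool) : Bool := !h && (v || x)

/-- vertical increments along a row -/
def rowv (v : Bool) (h x : ℕ → Bool) : ℕ → Bool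
  | 0 => v
  | i + 1 => vout (h i) (rowv v h x i) (x i)

/-- new horizontal increments (truncated at `m`) -/
def rowh (m : ℕ) (v : Bool) (h x : ℕ → Bool) (i : ℕ) : Bool :=
  if i < m then hout (h i) (rowv v h x i) (x i) else false

theorem rowv_congr (v : Bool) (h x h' x' : ℕ → Bool) (m : ℕ) (hh : ∀ i < m, h i = h' i)
    (hx : ∀ i < m, x i = x' i) : rowv v h x m = rowv v h' x' m := by
  induction m with
  | zero => rfl
  | succ m ih =>
    rw [rowv, rowv, ih (fun i hi => hh i (by omega)) (fun i hi => hx i (by omega)),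
      hh m (by omega), hx m (by omega)]

theorem rowh_succ (m : ℕ) (v b c : Bool) (h x : ℕ → Bool) :
    rowh (m + 1) v (Function.update h m b) (Function.update x m c) =
      Function.update (rowh m v h x) m (hout b (rowv v h x m) c) := by
  have key : ∀ i ≤ m, rowv v (Function.update h m b) (Function.update x m c) i = rowv v h x i := by
    intro i hi
    apply rowv_congr
    · intro k hk; exact Function.update_of_ne (by omega) _ _
    · intro k hk; exact Function.update_of_ne (by omega) _ _
  funext i
  rcases lt_trichotomy i m with hi | hi | hi
  · simp [rowh, hi, Function.update_of_ne hi.ne, key i hi.le, Nat.lt_succ_of_lt hi]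
  · subst hi; simp [rowh, key]
  · rw [Function.update_of_ne hi.ne']
    simp [rowh, show ¬ i < m + 1 by omega, show ¬ i < m by omega]

theorem rowv_succ (m : ℕ) (v b c : Bool) (h x : ℕ → Bool) :
    rowv v (Function.update h m b) (Function.update x m c) (m + 1) =
      vout b (rowv v h x m) c := by
  rw [rowv]
  simp only [Function.update_self]
  congr 1
  apply rowv_congr
  · intro k hk; exact Function.update_of_ne (by omega) _ _
  · intro k hk; exact Function.update_of_ne (by omega) _ _

open Ex

theorem burke_row (a b p : ℝ) (ha0 : 0 ≤ a) (ha1 : a ≤ 1) (hb0 : 0 ≤ b) (hb1 : b ≤ 1)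
    (hp0 : 0 ≤ p) (hp1 : p ≤ 1) (hab : a * b = p * (1 - a) * (1 - b)) (m : ℕ) :
    ∀ Φ : (ℕ → Bool) → Bool → ℝ,
    (iid (ber a ha0 ha1) false m).toFun (fun h => (ber b hb0 hb1).toFun fun v =>
      (iid (ber p hp0 hp1) false m).toFun fun x => Φ (rowh m v h x) (rowv v h x m)) =
    (iid (ber a ha0 ha1) false m).toFun (fun h => (ber b hb0 hb1).toFun fun v => Φ h v) := by
  induction m with
  | zero =>
    intro Φ
    simp only [iid_zero, rowv]
    congr 1
  | succ m ih =>
    intro Φ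
    have h1 := ih (fun h v => (ber a ha0 ha1).toFun fun c => (ber p hp0 hp1).toFun fun y =>
      Φ (Function.update h m (hout c v y)) (vout c v y))
    simp only [iid_succ, rowh_succ, rowv_succ]
    refine Eq.trans ?_ (h1.trans ?_)
    · congr 1; funext h
      rw [ber_swap]
      congr 1; funext v
      rw [ber_swap]
    congr 1; funext h
    simp only [ber_apply, hout, vout]
    simp
    linear_combination (Φ (Function.update h m false) false - Φ (Function.update h m true) true) * hab

/-- state of the horizontal increments after `n` rows; row `j` is described by `ρ j`. -/
def hstate (m : ℕ) (s : ℕ → Bool) (ρ : ℕ → Bool × (ℕ → Bool)) : ℕ → (ℕ → Bool)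
  | 0 => s
  | n + 1 => rowh m (ρ n).1 (hstate m s ρ n) (ρ n).2

theorem hstate_congr (m : ℕ) (s : ℕ → Bool) (ρ ρ' : ℕ → Bool × (ℕ → Bool)) (n : ℕ)
    (h : ∀ i < n, ρ i = ρ' i) : hstate m s ρ n = hstate m s ρ' n := by
  induction n with
  | zero => rfl
  | succ n ih => rw [hstate, hstate, h n (by omega), ih fun i hi => h i (by omega)]

theorem burke (a b p : ℝ) (ha0 : 0 ≤ a) (ha1 : a ≤ 1) (hb0 : 0 ≤ b) (hb1 : b ≤ 1)
    (hp0 : 0 ≤ p) (hp1 : p ≤ 1) (hab : a * b = p * (1 - a) * (1 - b)) (m n : ℕ)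
    (d : Bool × (ℕ → Bool)) :
    ∀ Φ : (ℕ → Bool) → ℝ,
    (iid (ber a ha0 ha1) false m).toFun (fun s =>
      (iid (prod (ber b hb0 hb1) (iid (ber p hp0 hp1) false m)) d n).toFun fun ρ =>
        Φ (hstate m s ρ n)) =
    (iid (ber a ha0 ha1) false m).toFun Φ := by
  induction n with
  | zero => intro Φ; rfl
  | succ n ih =>
    intro Φ
    have h2 := burke_row a b p ha0 ha1 hb0 hb1 hp0 hp1 hab m (fun h _ => Φ h)
    have h3 : ∀ s ρ r, hstate m s (Function.update ρ n r) (n + 1) =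
        rowh m r.1 (hstate m s ρ n) r.2 := by
      intro s ρ r
      rw [hstate, Function.update_self]
      rw [hstate_congr m s _ ρ n fun i hi => Function.update_of_ne hi.ne _ _]
    simp only [iid_succ, h3, prod_apply]
    rw [ih (fun h => (ber b hb0 hb1).toFun fun v =>
      (iid (ber p hp0 hp1) false m).toFun fun x => Φ (rowh m v h x)), h2]
    simp only [Ex.const]

theorem cnt_eq_bz (m : ℕ) (x : ℕ → Bool) : cnt (m + 1) x = cnt m x + bz (x m) := cnt_succ m x

theorem lpp_eq (m : ℕ) (s : ℕ → Bool) (ρ : ℕ → Bool × (ℕ → Bool)) (n : ℕ) :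
    ∀ i ≤ m, lpp (fun j => (ρ j).2) (fun i => cnt i s) (fun j => cnt j fun k => (ρ k).1) i n =
      cnt n (fun k => (ρ k).1) + cnt i (hstate m s ρ n) := by
  induction n with
  | zero => intro i hi; rw [lpp_zero_right]; simp only [hstate]; simp [cnt]
  | succ n ih =>
    have key : ∀ i ≤ m,
        lpp (fun j => (ρ j).2) (fun i => cnt i s) (fun j => cnt j fun k => (ρ k).1) i (n + 1) =
          cnt (n + 1) (fun k => (ρ k).1) + cnt i (hstate m s ρ (n + 1)) ∧
        lpp (fun j => (ρ j).2) (fun i => cnt i s) (fun j => cnt j fun k => (ρ k).1) i (n + 1) =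
          cnt n (fun k => (ρ k).1) + cnt i (hstate m s ρ n) +
            bz (rowv (ρ n).1 (hstate m s ρ n) (ρ n).2 i) := by
      intro i
      induction i with
      | zero =>
        intro _
        rw [lpp_zero_left, cnt_eq_bz]
        simp [rowv, cnt]
      | succ i ihi =>
        intro hi
        obtain ⟨e1, e2⟩ := ihi (by omega)
        rw [lpp_succ, ih i (by omega), ih (i + 1) hi]
        have e3 : hstate m s ρ (n + 1) i = hout (hstate m s ρ n i)
            (rowv (ρ n).1 (hstate m s ρ n) (ρ n).2 i) ((ρ n).2 i) := by
          rw [hstate, rowh, if_pos (by omega)]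
        rw [cnt_eq_bz i, cnt_eq_bz i, e3, rowv]
        have e4 := e1.symm.trans e2
        rw [e2]
        generalize hstate m s ρ n i = h at *
        generalize rowv (ρ n).1 (hstate m s ρ n) (ρ n).2 i = v at *
        generalize (ρ n).2 i = x at *
        cases h <;> cases v <;> cases x <;> simp [bz, hout, vout] at * <;> omega
    intro i hi
    exact (key i hi).1

/-! ### Concentration for the Bernoulli field -/
open Ex

namespace Ex
variable {α β γ δ : Type}

theorem prod_map (E1 : Ex α) (E2 : Ex β) (E1' : Ex γ) (E2' : Ex δ) (g1 : α → γ) (g2 : β → δ)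
    (h1 : ∀ f : γ → ℝ, E1.toFun (fun a => f (g1 a)) = E1'.toFun f)
    (h2 : ∀ f : δ → ℝ, E2.toFun (fun a => f (g2 a)) = E2'.toFun f) (f : γ × δ → ℝ) :
    (prod E1 E2).toFun (fun x => f (g1 x.1, g2 x.2)) = (prod E1' E2').toFun f := by
  rw [prod_apply, prod_apply, ← h1]
  congr 1; funext a
  exact h2 (fun b => f (g1 a, b))

theorem pr_map (E : Ex α) (E' : Ex β) (g : α → β)
    (h : ∀ f : β → ℝ, E.toFun (fun a => f (g a)) = E'.toFun f) (A : β → Prop) :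
    E.pr (fun a => A (g a)) = E'.pr A := by
  classical
  exact h (fun b => @ite ℝ (A b) (Classical.propDecidable _) 1 0)

end Ex

/-- stationary model -/
noncomputable def stat (a b p : ℝ) (ha0 : 0 ≤ a) (ha1 : a ≤ 1) (hb0 : 0 ≤ b) (hb1 : b ≤ 1)
    (hp0 : 0 ≤ p) (hp1 : p ≤ 1) (M : ℕ) : Ex ((ℕ → Bool) × (ℕ → Bool × (ℕ → Bool))) :=
  prod (iid (ber a ha0 ha1) false M)
    (iid (prod (ber b hb0 hb1) (iid (ber p hp0 hp1) false M)) (false, fun _ => false) M)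

/-- stationary last passage time -/
def slpp (M : ℕ) (ω : (ℕ → Bool) × (ℕ → Bool × (ℕ → Bool))) : ℤ :=
  lpp (fun j => (ω.2 j).2) (fun i => cnt i ω.1) (fun j => cnt j fun k => (ω.2 k).1) M M

/-- the Bernoulli field -/
noncomputable def fld (p : ℝ) (hp0 : 0 ≤ p) (hp1 : p ≤ 1) (M : ℕ) : Ex (ℕ → ℕ → Bool) :=
  iid (iid (ber p hp0 hp1) false M) (fun _ => false) M

theorem stat_law_h (a b p : ℝ) (ha0 : 0 ≤ a) (ha1 : a ≤ 1) (hb0 : 0 ≤ b) (hb1 : b ≤ 1)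
    (hp0 : 0 ≤ p) (hp1 : p ≤ 1) (hab : a * b = p * (1 - a) * (1 - b)) (M : ℕ)
    (f : (ℕ → Bool) → ℝ) :
    (stat a b p ha0 ha1 hb0 hb1 hp0 hp1 M).toFun (fun ω => f (hstate M ω.1 ω.2 M)) =
      (iid (ber a ha0 ha1) false M).toFun f :=
  burke a b p ha0 ha1 hb0 hb1 hp0 hp1 hab M M (false, fun _ => false) f

theorem stat_law_t (a b p : ℝ) (ha0 : 0 ≤ a) (ha1 : a ≤ 1) (hb0 : 0 ≤ b) (hb1 : b ≤ 1)
    (hp0 : 0 ≤ p) (hp1 : p ≤ 1) (M : ℕ) (f : (ℕ → Bool) → ℝ) :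
    (stat a b p ha0 ha1 hb0 hb1 hp0 hp1 M).toFun (fun ω => f (fun k => (ω.2 k).1)) =
      (iid (ber b hb0 hb1) false M).toFun f := by
  unfold stat
  rw [prod_snd _ _ (fun ρ : ℕ → Bool × (ℕ → Bool) => f fun k => (ρ k).1)]
  exact iid_map _ (ber b hb0 hb1) _ Prod.fst (fun f => prod_fst _ _ f) M f

theorem stat_law_x (a b p : ℝ) (ha0 : 0 ≤ a) (ha1 : a ≤ 1) (hb0 : 0 ≤ b) (hb1 : b ≤ 1)
    (hp0 : 0 ≤ p) (hp1 : p ≤ 1) (M : ℕ) (f : (ℕ → ℕ → Bool) → ℝ) :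
    (stat a b p ha0 ha1 hb0 hb1 hp0 hp1 M).toFun (fun ω => f (fun k => (ω.2 k).2)) =
      (fld p hp0 hp1 M).toFun f := by
  unfold stat
  rw [prod_snd _ _ (fun ρ : ℕ → Bool × (ℕ → Bool) => f fun k => (ρ k).2)]
  exact iid_map _ (iid (ber p hp0 hp1) false M) _ Prod.snd (fun f => prod_snd _ _ f) M f

theorem conc_two {Ω : Type} (E : Ex Ω) (X Y Z : Ω → ℝ) (hZ : ∀ ω, Z ω = X ω + Y ω)
    (x y t u v : ℝ) (h1 : E.pr (fun ω => t ≤ |X ω - x|) ≤ u)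
    (h2 : E.pr (fun ω => t ≤ |Y ω - y|) ≤ v) :
    E.pr (fun ω => 2 * t ≤ |Z ω - (x + y)|) ≤ u + v := by
  refine le_trans (pr_mono E _ (fun ω => t ≤ |X ω - x| ∨ t ≤ |Y ω - y|) ?_)
    ((pr_or _ _ _).trans (add_le_add h1 h2))
  intro ω h
  rw [hZ] at h
  by_contra hc
  rw [not_or, not_le, not_le, abs_lt, abs_lt] at hc
  obtain ⟨c1, c2⟩ := hc
  rw [le_abs] at h
  rcases h with h | h <;> linarith

theorem slpp_eq (M : ℕ) (ω : (ℕ → Bool) × (ℕ → Bool × (ℕ → Bool))) :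
    (slpp M ω : ℝ) = (cnt M (hstate M ω.1 ω.2 M) : ℝ) + (cnt M (fun k => (ω.2 k).1) : ℝ) := by
  have h := lpp_eq M ω.1 ω.2 M M le_rfl
  have h' : slpp M ω = cnt M (hstate M ω.1 ω.2 M) + cnt M (fun k => (ω.2 k).1) := by
    rw [slpp, h]; ring
  rw [h']; exact Int.cast_add _ _

theorem stat_conc (a b p : ℝ) (ha0 : 0 ≤ a) (ha1 : a ≤ 1) (hb0 : 0 ≤ b) (hb1 : b ≤ 1)
    (hp0 : 0 ≤ p) (hp1 : p ≤ 1) (hab : a * b = p * (1 - a) * (1 - b)) (M : ℕ) (t : ℝ)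
    (ht : 0 < t) :
    (stat a b p ha0 ha1 hb0 hb1 hp0 hp1 M).pr (fun ω => 2 * t ≤ |(slpp M ω : ℝ) - (a + b) * M|) ≤
      (a + b) * M / t ^ 2 := by
  have h1 := pr_map _ _ _ (stat_law_h a b p ha0 ha1 hb0 hb1 hp0 hp1 hab M)
      (fun x => t ≤ |(cnt M x : ℝ) - a * M|)
  have h1' := h1.le.trans (chebyshev a ha0 ha1 M M le_rfl t ht)
  have h2 := pr_map _ _ _ (stat_law_t a b p ha0 ha1 hb0 hb1 hp0 hp1 M)
      (fun x => t ≤ |(cnt M x : ℝ) - b * M|)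
  have h2' := h2.le.trans (chebyshev b hb0 hb1 M M le_rfl t ht)
  have := conc_two _ _ _ _ (slpp_eq M) _ _ t _ _ h1' h2'
  rw [← add_mul, ← add_div, ← add_mul] at this
  exact this

theorem upper_fld (a p : ℝ) (ha0 : 0 ≤ a) (ha1 : a ≤ 1)
    (hp0 : 0 ≤ p) (hp1 : p ≤ 1) (hab : a * a = p * (1 - a) * (1 - a)) (M : ℕ) (t : ℝ)
    (ht : 0 < t) :
    (fld p hp0 hp1 M).pr (fun ξ => 2 * a * M + 2 * t ≤ (lis0 ξ M M : ℝ)) ≤ 2 * a * M / t ^ 2 := by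
  have h := stat_conc a a p ha0 ha1 ha0 ha1 hp0 hp1 hab M t ht
  have e : (stat a a p ha0 ha1 ha0 ha1 hp0 hp1 M).pr
      (fun ω => 2 * a * M + 2 * t ≤ (lis0 (fun j => (ω.2 j).2) M M : ℝ)) =
      (fld p hp0 hp1 M).pr (fun ξ => 2 * a * M + 2 * t ≤ (lis0 ξ M M : ℝ)) :=
    pr_map _ _ _ (stat_law_x a a p ha0 ha1 ha0 ha1 hp0 hp1 M)
      (fun ξ => 2 * a * M + 2 * t ≤ (lis0 ξ M M : ℝ))
  rw [← e]
  refine le_trans (pr_mono _ _ _ ?_) (h.trans (le_of_eq (by ring)))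
  intro ω hω
  have h3 : (lis0 (fun j => (ω.2 j).2) M M : ℝ) ≤ slpp M ω := by
    exact_mod_cast lis0_le _ _ _ _ _
  rw [le_abs]; left; linarith

/-- threshold maps -/
def thr (k : ℕ) (u : Fin 4) : Bool := decide (k ≤ u.val)

theorem thr_mono (k l : ℕ) (h : l ≤ k) (u : Fin 4) : bz (thr k u) ≤ bz (thr l u) := by
  unfold bz thr
  by_cases h1 : k ≤ u.val
  · simp [h1, h.trans h1]
  · simp only [h1]; simp; split_ifs <;> norm_num

section lower
variable (a1 a2 a3 p : ℝ) (h0 : 0 ≤ a3) (h1 : a3 ≤ a2) (h2 : a2 ≤ a1) (h3 : a1 ≤ 1)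
    (hp0 : 0 ≤ p) (hp1 : p ≤ 1)

theorem four1 (f : Bool → ℝ) : (four a1 a2 a3 h0 h1 h2 h3).toFun (fun u => f (thr 1 u)) =
    (ber a1 (h0.trans (h1.trans h2)) h3).toFun f := by
  simp [four, ber, thr]; ring
theorem four2 (f : Bool → ℝ) : (four a1 a2 a3 h0 h1 h2 h3).toFun (fun u => f (thr 2 u)) =
    (ber a2 (h0.trans h1) (h2.trans h3)).toFun f := by
  simp [four, ber, thr]; ring
theorem four3 (f : Bool → ℝ) : (four a1 a2 a3 h0 h1 h2 h3).toFun (fun u => f (thr 3 u)) =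
    (ber a3 h0 (h1.trans (h2.trans h3))).toFun f := by
  simp [four, ber, thr]; ring

/-- joint model -/
noncomputable def joint (M : ℕ) : Ex ((ℕ → Fin 4) × (ℕ → Fin 4 × (ℕ → Bool))) :=
  prod (iid (four a1 a2 a3 h0 h1 h2 h3) 0 M)
    (iid (prod (four a1 a2 a3 h0 h1 h2 h3) (iid (ber p hp0 hp1) false M)) (0, fun _ => false) M)

/-- projection to a stationary model -/
def proj (k l : ℕ) (ω : (ℕ → Fin 4) × (ℕ → Fin 4 × (ℕ → Bool))) :
    (ℕ → Bool) × (ℕ → Bool × (ℕ → Bool)) :=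
  (fun i => thr k (ω.1 i), fun j => (thr l (ω.2 j).1, (ω.2 j).2))

theorem joint_map (M : ℕ) (k l : ℕ) (b c : ℝ) (hb0 : 0 ≤ b) (hb1 : b ≤ 1) (hc0 : 0 ≤ c)
    (hc1 : c ≤ 1) (hk : 1 ≤ k) (hl : 1 ≤ l)
    (hb : ∀ f : Bool → ℝ, (four a1 a2 a3 h0 h1 h2 h3).toFun (fun u => f (thr k u)) =
      (ber b hb0 hb1).toFun f)
    (hc : ∀ f : Bool → ℝ, (four a1 a2 a3 h0 h1 h2 h3).toFun (fun u => f (thr l u)) =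
      (ber c hc0 hc1).toFun f) (f : (ℕ → Bool) × (ℕ → Bool × (ℕ → Bool)) → ℝ) :
    (joint a1 a2 a3 p h0 h1 h2 h3 hp0 hp1 M).toFun (fun ω => f (proj k l ω)) =
      (stat b c p hb0 hb1 hc0 hc1 hp0 hp1 M).toFun f := by
  have t0 : ∀ k, 1 ≤ k → thr k 0 = false := by intro k hk; simp [thr]; omega
  refine prod_map _ _ (iid (ber b hb0 hb1) false M)
    (iid (prod (ber c hc0 hc1) (iid (ber p hp0 hp1) false M)) (false, fun _ => false) M)
    (fun (U : ℕ → Fin 4) i => thr k (U i)) (fun (V : ℕ → Fin 4 × (ℕ → Bool)) j => (thr l (V j).1, (V j).2)) ?_ ?_ f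
  · intro f
    have := iid_map (four a1 a2 a3 h0 h1 h2 h3) (ber b hb0 hb1) 0 (thr k) hb M f
    rwa [t0 k hk] at this
  · intro f
    have := iid_map (prod (four a1 a2 a3 h0 h1 h2 h3) (iid (ber p hp0 hp1) false M))
      (prod (ber c hc0 hc1) (iid (ber p hp0 hp1) false M)) (0, fun _ => false)
      (fun v => (thr l v.1, v.2))
      (fun f => prod_map _ _ _ _ (thr l) id hc (fun _ => rfl) f) M f
    simpa only [t0 l hl] using this

theorem joint_law_x (M : ℕ) (f : (ℕ → ℕ → Bool) → ℝ) :
    (joint a1 a2 a3 p h0 h1 h2 h3 hp0 hp1 M).toFun (fun ω => f (fun k => (ω.2 k).2)) =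
      (fld p hp0 hp1 M).toFun f := by
  unfold joint
  rw [prod_snd _ _ (fun ρ : ℕ → Fin 4 × (ℕ → Bool) => f fun k => (ρ k).2)]
  exact iid_map _ (iid (ber p hp0 hp1) false M) _ Prod.snd (fun f => prod_snd _ _ f) M f

theorem joint_law_1 (M : ℕ) (k : ℕ) (b : ℝ) (hb0 : 0 ≤ b) (hb1 : b ≤ 1) (hk : 1 ≤ k)
    (hb : ∀ f : Bool → ℝ, (four a1 a2 a3 h0 h1 h2 h3).toFun (fun u => f (thr k u)) =
      (ber b hb0 hb1).toFun f) (f : (ℕ → Bool) → ℝ) :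
    (joint a1 a2 a3 p h0 h1 h2 h3 hp0 hp1 M).toFun (fun ω => f (fun i => thr k (ω.1 i))) =
      (iid (ber b hb0 hb1) false M).toFun f := by
  have t0 : thr k 0 = false := by simp [thr]; omega
  have := iid_map (four a1 a2 a3 h0 h1 h2 h3) (ber b hb0 hb1) 0 (thr k) hb M f
  rw [t0] at this
  unfold joint
  rw [prod_fst _ _ (fun ρ : ℕ → Fin 4 => f fun i => thr k (ρ i))]
  exact this

theorem joint_law_2 (M : ℕ) (k : ℕ) (b : ℝ) (hb0 : 0 ≤ b) (hb1 : b ≤ 1) (hk : 1 ≤ k)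
    (hb : ∀ f : Bool → ℝ, (four a1 a2 a3 h0 h1 h2 h3).toFun (fun u => f (thr k u)) =
      (ber b hb0 hb1).toFun f) (f : (ℕ → Bool) → ℝ) :
    (joint a1 a2 a3 p h0 h1 h2 h3 hp0 hp1 M).toFun (fun ω => f (fun i => thr k (ω.2 i).1)) =
      (iid (ber b hb0 hb1) false M).toFun f := by
  have t0 : thr k 0 = false := by simp [thr]; omega
  have := iid_map (prod (four a1 a2 a3 h0 h1 h2 h3) (iid (ber p hp0 hp1) false M))
    (ber b hb0 hb1) (0, fun _ => false) (fun v => thr k v.1)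
    (fun f => (prod_fst _ _ (fun u => f (thr k u))).trans (hb f)) M f
  rw [t0] at this
  unfold joint
  rw [prod_snd _ _ (fun ρ : ℕ → Fin 4 × (ℕ → Bool) => f fun i => thr k (ρ i).1)]
  exact this

theorem joint_cnt1 (M : ℕ) (k n : ℕ) (b : ℝ) (hb0 : 0 ≤ b) (hb1 : b ≤ 1) (hk : 1 ≤ k)
    (hn : n ≤ M)
    (hb : ∀ f : Bool → ℝ, (four a1 a2 a3 h0 h1 h2 h3).toFun (fun u => f (thr k u)) =
      (ber b hb0 hb1).toFun f) (t : ℝ) (ht : 0 < t) :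
    (joint a1 a2 a3 p h0 h1 h2 h3 hp0 hp1 M).pr
      (fun ω => t ≤ |(cnt n (fun i => thr k (ω.1 i)) : ℝ) - b * n|) ≤ b * n / t ^ 2 := by
  rw [pr_map _ _ _ (joint_law_1 a1 a2 a3 p h0 h1 h2 h3 hp0 hp1 M k b hb0 hb1 hk hb)
      (fun x => t ≤ |(cnt n x : ℝ) - b * n|)]
  exact chebyshev b hb0 hb1 M n hn t ht

theorem joint_cnt2 (M : ℕ) (k n : ℕ) (b : ℝ) (hb0 : 0 ≤ b) (hb1 : b ≤ 1) (hk : 1 ≤ k)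
    (hn : n ≤ M)
    (hb : ∀ f : Bool → ℝ, (four a1 a2 a3 h0 h1 h2 h3).toFun (fun u => f (thr k u)) =
      (ber b hb0 hb1).toFun f) (t : ℝ) (ht : 0 < t) :
    (joint a1 a2 a3 p h0 h1 h2 h3 hp0 hp1 M).pr
      (fun ω => t ≤ |(cnt n (fun i => thr k (ω.2 i).1) : ℝ) - b * n|) ≤ b * n / t ^ 2 := by
  rw [pr_map _ _ _ (joint_law_2 a1 a2 a3 p h0 h1 h2 h3 hp0 hp1 M k b hb0 hb1 hk hb)
      (fun x => t ≤ |(cnt n x : ℝ) - b * n|)]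
  exact chebyshev b hb0 hb1 M n hn t ht

end lower

theorem lower_fld (a1 a2 a3 p : ℝ) (h0 : 0 ≤ a3) (h1 : a3 ≤ a2) (h2 : a2 ≤ a1) (h3 : a1 ≤ 1)
    (hp0 : 0 ≤ p) (hp1 : p ≤ 1) (h22 : a2 * a2 = p * (1 - a2) * (1 - a2))
    (h13 : a1 * a3 = p * (1 - a1) * (1 - a3)) (M n : ℕ) (hn : n ≤ M) (t : ℝ) (ht : 0 < t)
    (hcond : (a1 + a3 - 2 * a2) * M + 6 * t ≤ (a1 - a2) * n) :
    (fld p hp0 hp1 M).pr (fun ξ => (lis0 ξ M M : ℝ) ≤ 2 * a2 * M - a2 * n - 3 * t) ≤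
      10 * a1 * M / t ^ 2 := by
  set J := joint a1 a2 a3 p h0 h1 h2 h3 hp0 hp1 M with hJ
  have a10 := h0.trans (h1.trans h2)
  have a20 := h0.trans h1
  have a21 := h2.trans h3
  have a31 := h1.trans a21
  have e : J.pr (fun ω => (lis0 (fun j => (ω.2 j).2) M M : ℝ) ≤ 2 * a2 * M - a2 * n - 3 * t) =
      (fld p hp0 hp1 M).pr (fun ξ => (lis0 ξ M M : ℝ) ≤ 2 * a2 * M - a2 * n - 3 * t) :=
    pr_map _ _ _ (joint_law_x a1 a2 a3 p h0 h1 h2 h3 hp0 hp1 M)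
      (fun ξ => (lis0 ξ M M : ℝ) ≤ 2 * a2 * M - a2 * n - 3 * t)
  rw [← e]
  have f1 := four1 a1 a2 a3 h0 h1 h2 h3
  have f2 := four2 a1 a2 a3 h0 h1 h2 h3
  have f3 := four3 a1 a2 a3 h0 h1 h2 h3
  have g1 := (pr_map _ _ _ (joint_map a1 a2 a3 p h0 h1 h2 h3 hp0 hp1 M 2 2 a2 a2 a20 a21 a20 a21
    (by norm_num) (by norm_num) f2 f2) _).le.trans
      (stat_conc a2 a2 p a20 a21 a20 a21 hp0 hp1 h22 M t ht)
  have g2 := (pr_map _ _ _ (joint_map a1 a2 a3 p h0 h1 h2 h3 hp0 hp1 M 1 3 a1 a3 a10 h3 h0 a31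
    (by norm_num) (by norm_num) f1 f3) _).le.trans
      (stat_conc a1 a3 p a10 h3 h0 a31 hp0 hp1 h13 M t ht)
  have g3 := (pr_map _ _ _ (joint_map a1 a2 a3 p h0 h1 h2 h3 hp0 hp1 M 3 1 a3 a1 h0 a31 a10 h3
    (by norm_num) (by norm_num) f3 f1) _).le.trans
      (stat_conc a3 a1 p h0 a31 a10 h3 hp0 hp1 (by linarith) M t ht)
  have g4 := joint_cnt1 a1 a2 a3 p h0 h1 h2 h3 hp0 hp1 M 2 n a2 a20 a21 (by norm_num) hn f2 t ht
  have g5 := joint_cnt1 a1 a2 a3 p h0 h1 h2 h3 hp0 hp1 M 1 n a1 a10 h3 (by norm_num) hn f1 t ht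
  have g6 := joint_cnt2 a1 a2 a3 p h0 h1 h2 h3 hp0 hp1 M 2 n a2 a20 a21 (by norm_num) hn f2 t ht
  have g7 := joint_cnt2 a1 a2 a3 p h0 h1 h2 h3 hp0 hp1 M 1 n a1 a10 h3 (by norm_num) hn f1 t ht
  rw [← hJ] at g1 g2 g3 g4 g5 g6 g7
  have hnM : (n : ℝ) ≤ M := by exact_mod_cast hn
  have hM : (0 : ℝ) ≤ M := Nat.cast_nonneg _
  calc _ ≤ _ := pr_mono _ _ _ ?_
    _ ≤ _ := (pr_or _ _ _).trans (add_le_add g1 ((pr_or _ _ _).trans (add_le_add g2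
      ((pr_or _ _ _).trans (add_le_add g3 ((pr_or _ _ _).trans (add_le_add g4
      ((pr_or _ _ _).trans (add_le_add g5 ((pr_or _ _ _).trans (add_le_add g6 g7)))))))))))
    _ ≤ _ := by
      have k1 : a2 * M ≤ a1 * M := by gcongr
      have k2 : a3 * M ≤ a2 * M := by gcongr
      have k3 : a2 * n ≤ a1 * M := by gcongr
      have k4 : a1 * n ≤ a1 * M := by gcongr
      simp only [← add_div]
      apply div_le_div_of_nonneg_right _ (by positivity)
      nlinarith
  intro ω hω
  by_contra hc
  push Not at hc
  obtain ⟨c1, c2, c3, c4, c5, c6, c7⟩ := hc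
  have kd := key_det (fun j => (ω.2 j).2) (fun i => thr 2 (ω.1 i)) (fun i => thr 2 (ω.2 i).1)
    (fun i => thr 1 (ω.1 i)) (fun i => thr 3 (ω.2 i).1)
    (fun i => thr 3 (ω.1 i)) (fun i => thr 1 (ω.2 i).1) n
    (fun i => thr_mono _ _ (by norm_num) _) (fun i => thr_mono _ _ (by norm_num) _) M M
  simp only [slpp, proj] at c1 c2 c3
  rw [abs_lt] at c1 c2 c3 c4 c5 c6 c7
  rcases le_max_iff.1 kd with kd | kd
  · rcases max_cases (cnt n fun i => thr 2 (ω.1 i)) (cnt n fun i => thr 2 (ω.2 i).1) with h | h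
    · rw [h.1] at kd
      have kd' := (Int.cast_le (R := ℝ)).2 kd
      push_cast at kd'
      linarith
    · rw [h.1] at kd
      have kd' := (Int.cast_le (R := ℝ)).2 kd
      push_cast at kd'
      linarith
  · rcases le_max_iff.1 kd with kd | kd
    · have kd' := (Int.cast_le (R := ℝ)).2 kd
      push_cast at kd'
      linarith
    · have kd' := (Int.cast_le (R := ℝ)).2 kd
      push_cast at kd'
      linarith

/-! ### Numerical limits for the Bernoulli field -/
open Filter Topology Ex

/-- cell probability -/
noncomputable def pm (l : ℝ) (M : ℕ) : ℝ := 1 - Real.exp (-(l / (M : ℝ) ^ 2))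

theorem pm_nonneg {l : ℝ} (hl : 0 ≤ l) (M : ℕ) : 0 ≤ pm l M := by
  unfold pm
  have : Real.exp (-(l / (M : ℝ) ^ 2)) ≤ 1 := by
    apply Real.exp_le_one_iff.2; have : 0 ≤ l / (M : ℝ) ^ 2 := by positivity
    linarith
  linarith

theorem pm_le_one (l : ℝ) (M : ℕ) : pm l M ≤ 1 := by
  unfold pm; linarith [Real.exp_pos (-(l / (M : ℝ) ^ 2))]

theorem tendsto_inv_sq (l : ℝ) : Tendsto (fun M : ℕ => l / (M : ℝ) ^ 2) atTop (𝓝 0) := by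
  apply Tendsto.div_atTop tendsto_const_nhds
  exact (tendsto_pow_atTop two_ne_zero).comp tendsto_natCast_atTop_atTop

theorem tendsto_pm {l : ℝ} (hl : 0 ≤ l) :
    Tendsto (fun M : ℕ => (M : ℝ) ^ 2 * pm l M) atTop (𝓝 l) := by
  have h1 : Tendsto (fun M : ℕ => l / (1 + l / (M : ℝ) ^ 2)) atTop (𝓝 l) := by
    have := (tendsto_const_nhds (x := l)).div ((tendsto_const_nhds (x := (1 : ℝ))).add
      (tendsto_inv_sq l)) (by norm_num)
    rw [add_zero, div_one] at this; exact this
  refine tendsto_of_tendsto_of_tendsto_of_le_of_le' h1 tendsto_const_nhds ?_ ?_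
  · filter_upwards [eventually_gt_atTop 0] with M hM
    have hM' : (0 : ℝ) < M := by exact_mod_cast hM
    have hu : 0 ≤ l / (M : ℝ) ^ 2 := by positivity
    have he : Real.exp (-(l / (M : ℝ) ^ 2)) ≤ 1 / (1 + l / (M : ℝ) ^ 2) := by
      rw [Real.exp_neg, inv_eq_one_div]
      apply one_div_le_one_div_of_le (by linarith)
      linarith [Real.add_one_le_exp (l / (M : ℝ) ^ 2)]
    have : l / (1 + l / (M : ℝ) ^ 2) = (M : ℝ) ^ 2 * (1 - 1 / (1 + l / (M : ℝ) ^ 2)) := by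
      field_simp
      ring
    rw [this]
    apply mul_le_mul_of_nonneg_left _ (by positivity)
    unfold pm; linarith
  · filter_upwards [eventually_gt_atTop 0] with M hM
    have hM' : (0 : ℝ) < M := by exact_mod_cast hM
    have : l = (M : ℝ) ^ 2 * (l / (M : ℝ) ^ 2) := by field_simp
    conv_rhs => rw [this]
    apply mul_le_mul_of_nonneg_left _ (by positivity)
    unfold pm
    have := Real.add_one_le_exp (-(l / (M : ℝ) ^ 2))
    linarith

theorem tendsto_msqrt {l : ℝ} (hl : 0 ≤ l) :
    Tendsto (fun M : ℕ => (M : ℝ) * √(pm l M)) atTop (𝓝 (√l)) := by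
  have := (Real.continuous_sqrt.tendsto l).comp (tendsto_pm hl)
  refine this.congr fun M => ?_
  simp only [Function.comp]
  rw [Real.sqrt_mul (by positivity), Real.sqrt_sq (by positivity)]

theorem tendsto_sqrt_pm (l : ℝ) : Tendsto (fun M : ℕ => √(pm l M)) atTop (𝓝 0) := by
  have h : Tendsto (fun M : ℕ => pm l M) atTop (𝓝 0) := by
    have := (Real.continuous_exp.tendsto _).comp (tendsto_inv_sq l).neg
    have := (tendsto_const_nhds (x := (1 : ℝ))).sub this
    simpa [pm] using this
  have := (Real.continuous_sqrt.tendsto 0).comp h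
  rw [Real.sqrt_zero] at this; exact this

/-- odds map -/
noncomputable def od (y : ℝ) : ℝ := y / (1 + y)

theorem od_nonneg {y : ℝ} (h : 0 ≤ y) : 0 ≤ od y := by unfold od; positivity
theorem od_le_one {y : ℝ} (h : 0 ≤ y) : od y ≤ 1 := by
  unfold od; rw [div_le_one (by linarith)]; linarith
theorem od_mono {y z : ℝ} (h : 0 ≤ y) (hz : y ≤ z) : od y ≤ od z := by
  unfold od; rw [div_le_div_iff₀ (by linarith) (by linarith)]; nlinarith
theorem od_mul {y z p : ℝ} (h : 0 ≤ y) (hz : 0 ≤ z) (hp : y * z = p) :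
    od y * od z = p * (1 - od y) * (1 - od z) := by
  unfold od; subst hp
  have : 1 + y ≠ 0 := by linarith
  have : 1 + z ≠ 0 := by linarith
  field_simp; ring

theorem tendsto_od {l : ℝ} (hl : 0 ≤ l) (r : ℝ) :
    Tendsto (fun M : ℕ => od (r * √(pm l M)) * (M : ℝ)) atTop (𝓝 (r * √l)) := by
  have h1 := (tendsto_msqrt hl).const_mul r
  have h2 := ((tendsto_sqrt_pm l).const_mul r).const_add 1
  have := h1.div h2 (by norm_num)
  simp only [mul_zero, add_zero, div_one] at this
  refine this.congr fun M => ?_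
  simp only [Pi.div_apply]
  unfold od; ring

theorem upper_U (ε η : ℝ) (hε : 0 < ε) (hη : 0 < η) : ∃ L : ℝ, 0 < L ∧ ∀ l, L ≤ l →
    ∀ᶠ M : ℕ in atTop, ∀ (h0 : 0 ≤ pm l M) (h1 : pm l M ≤ 1),
      (fld (pm l M) h0 h1 M).pr (fun ξ => (2 + ε) * √l ≤ (lis0 ξ M M : ℝ)) ≤ η := by
  set K := 256 / (ε ^ 2 * η) with hK
  have hK0 : 0 < K := by positivity
  refine ⟨K ^ 2, by positivity, fun l hl => ?_⟩
  have hl0 : 0 < l := lt_of_lt_of_le (by positivity) hl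
  have hN : K ≤ √l := Real.le_sqrt_of_sq_le hl
  have hN0 : 0 < √l := lt_of_lt_of_le hK0 hN
  set N := √l with hNdef
  have ht := tendsto_od hl0.le 1
  rw [one_mul] at ht
  have e1 := ht.eventually (gt_mem_nhds (show N < N + ε * N / 4 by nlinarith [mul_pos hε hN0]))
  have e2 := ht.eventually (gt_mem_nhds (show N < 2 * N by linarith))
  filter_upwards [e1, e2] with M e1 e2 h0 h1
  simp only [one_mul] at e1 e2
  have hs := Real.sqrt_nonneg (pm l M)
  have hu := upper_fld (od (√(pm l M))) (pm l M) (od_nonneg hs) (od_le_one hs) h0 h1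
    (od_mul hs hs (Real.mul_self_sqrt h0)) M (ε * N / 8) (by positivity)
  refine (pr_mono _ _ _ ?_).trans (hu.trans ?_)
  · intro ξ h
    refine le_trans ?_ h
    linarith [mul_pos hε hN0]
  · rw [div_le_iff₀ (by positivity)]
    have : K * (ε ^ 2 * η) = 256 := by rw [hK]; field_simp
    have h3 : 256 ≤ N * (ε ^ 2 * η) := by
      rw [← this]; exact mul_le_mul_of_nonneg_right hN (by positivity)
    have : η * (ε * N / 8) ^ 2 = N * (N * (ε ^ 2 * η)) / 64 := by ring
    rw [this]
    nlinarith

theorem lower_U' (ε η : ℝ) (hε : 0 < ε) (hε1 : ε ≤ 1) (hη : 0 < η) :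
    ∃ L : ℝ, 0 < L ∧ ∀ l, L ≤ l →
    ∀ᶠ M : ℕ in atTop, ∀ (h0 : 0 ≤ pm l M) (h1 : pm l M ≤ 1),
      (fld (pm l M) h0 h1 M).pr (fun ξ => (lis0 ξ M M : ℝ) ≤ (2 - ε) * √l) ≤ η := by
  set d := ε / 2 with hd
  have hd0 : 0 < d := by positivity
  have hd1 : d ≤ 1 / 2 := by linarith
  set r := 1 + d / 2 with hr
  have hr1 : 1 ≤ r := by linarith
  have hr2 : r ≤ 2 := by linarith
  have hr0 : 0 < r := by linarith
  set K := 30 * 48 ^ 2 / (d ^ 4 * η) with hK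
  have hK0 : 0 < K := by positivity
  refine ⟨K ^ 2, by positivity, fun l hl => ?_⟩
  have hl0 : 0 < l := lt_of_lt_of_le (by positivity) hl
  have hN : K ≤ √l := Real.le_sqrt_of_sq_le hl
  have hN0 : 0 < √l := lt_of_lt_of_le hK0 hN
  set N := √l with hNdef
  have t1 := tendsto_od hl0.le r
  have t2 := tendsto_od hl0.le 1
  have t3 := tendsto_od hl0.le r⁻¹
  have tn : Tendsto (fun M : ℕ => (⌊d * (M : ℝ)⌋₊ : ℝ) / M) atTop (𝓝 d) :=
    (tendsto_nat_floor_mul_div_atTop hd0.le).comp tendsto_natCast_atTop_atTop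
  have c1 := (((t1.sub t2).mul tn).sub ((t1.add t3).sub (t2.const_mul 2)))
  have c2 := ((t2.const_mul 2).sub (t2.mul tn))
  have hrinv : r⁻¹ ≤ 1 - d / 2 + d ^ 2 / 4 := by
    rw [inv_le_iff_one_le_mul₀ hr0, hr]
    have : 0 < d ^ 3 := by positivity
    nlinarith
  have e1 := c1.eventually (lt_mem_nhds (show d ^ 2 * N / 8 < _ by
    rw [show (r * √l - 1 * √l) * d - (r * √l + r⁻¹ * √l - 2 * (1 * √l)) =
      ((r - 1) * d - (r + r⁻¹ - 2)) * N by ring]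
    rw [show d ^ 2 * N / 8 = d ^ 2 / 8 * N by ring]
    apply mul_lt_mul_of_pos_right _ hN0
    rw [hr] at hrinv ⊢
    nlinarith))
  have e2 := c2.eventually (lt_mem_nhds (show (2 - ε) * N + d ^ 2 * N / 16 < _ by
    rw [show 2 * (1 * √l) - 1 * √l * d = (2 - d) * N by ring]
    rw [show (2 - ε) * N + d ^ 2 * N / 16 = (2 - ε + d ^ 2 / 16) * N by ring]
    apply mul_lt_mul_of_pos_right _ hN0
    nlinarith))
  have e3 := t1.eventually (gt_mem_nhds (show r * N < 3 * N by nlinarith))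
  filter_upwards [e1, e2, e3, eventually_gt_atTop 0] with M e1 e2 e3 hM h0 h1
  have hM' : (0 : ℝ) < M := by exact_mod_cast hM
  have hs := Real.sqrt_nonneg (pm l M)
  set x := √(pm l M) with hx
  set n := ⌊d * (M : ℝ)⌋₊ with hn
  have y1 : 0 ≤ r * x := by positivity
  have y2 : 0 ≤ 1 * x := by positivity
  have y3 : 0 ≤ r⁻¹ * x := by positivity
  have hri : r⁻¹ ≤ 1 := inv_le_one_of_one_le₀ hr1
  have hxx : x * x = pm l M := Real.mul_self_sqrt h0
  have hnM : n ≤ M := by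
    apply Nat.floor_le_of_le
    nlinarith
  have hnm (a : ℝ) : a * (M : ℝ) * ((n : ℝ) / M) = a * n := by field_simp
  have hu := lower_fld (od (r * x)) (od (1 * x)) (od (r⁻¹ * x)) (pm l M) (od_nonneg y3)
    (od_mono y3 (mul_le_mul_of_nonneg_right hri hs)) (od_mono y2 (mul_le_mul_of_nonneg_right hr1 hs))
    (od_le_one y1) h0 h1 (od_mul y2 y2 (by linarith)) (od_mul y1 y3 (by field_simp; linarith))
    M n hnM (d ^ 2 * N / 48) (by positivity) (by
      rw [← sub_mul, hnm] at e1
      linarith)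
  refine (pr_mono _ _ _ ?_).trans (hu.trans ?_)
  · intro ξ h
    refine le_trans h ?_
    rw [hnm] at e2
    linarith
  · rw [div_le_iff₀ (by positivity)]
    have : K * (d ^ 4 * η) = 30 * 48 ^ 2 := by rw [hK]; field_simp
    have h3 : 30 * 48 ^ 2 ≤ N * (d ^ 4 * η) := by
      rw [← this]; exact mul_le_mul_of_nonneg_right hN (by positivity)
    have : η * (d ^ 2 * N / 48) ^ 2 = N * (N * (d ^ 4 * η)) / 48 ^ 2 := by ring
    rw [this]
    nlinarith

theorem lower_U (ε η : ℝ) (hε : 0 < ε) (hη : 0 < η) :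
    ∃ L : ℝ, 0 < L ∧ ∀ l, L ≤ l →
    ∀ᶠ M : ℕ in atTop, ∀ (h0 : 0 ≤ pm l M) (h1 : pm l M ≤ 1),
      (fld (pm l M) h0 h1 M).pr (fun ξ => (lis0 ξ M M : ℝ) ≤ (2 - ε) * √l) ≤ η := by
  obtain ⟨L, hL, h⟩ := lower_U' (min ε 1) η (by positivity) (min_le_right _ _) hη
  refine ⟨L, hL, fun l hl => ?_⟩
  filter_upwards [h l hl] with M hM h0 h1
  refine (pr_mono _ _ _ ?_).trans (hM h0 h1)
  intro ξ hξ
  refine hξ.trans ?_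
  apply mul_le_mul_of_nonneg_right _ (Real.sqrt_nonneg _)
  linarith [min_le_left ε 1]

/-! ### Poissonization -/
section poisson

theorem exp_add_real {𝔸 : Type} [NormedRing 𝔸] [NormedAlgebra ℝ 𝔸] [CompleteSpace 𝔸] {x y : 𝔸}
    (h : Commute x y) : NormedSpace.exp (x + y) = NormedSpace.exp x * NormedSpace.exp y :=
  NormedSpace.exp_add_of_commute_of_mem_ball (𝕂 := ℝ) h
    ((NormedSpace.expSeries_radius_eq_top ℝ 𝔸).symm ▸ edist_lt_top _ _)
    ((NormedSpace.expSeries_radius_eq_top ℝ 𝔸).symm ▸ edist_lt_top _ _)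

theorem exp_idem {𝔸 : Type} [NormedRing 𝔸] [NormedAlgebra ℝ 𝔸] [CompleteSpace 𝔸] {P : 𝔸}
    (h : P * P = P) (s : ℝ) : NormedSpace.exp (s • P) = 1 + (Real.exp s - 1) • P := by
  have h1 := NormedSpace.exp_series_hasSum_exp' (𝕂 := ℝ) (s • P)
  have hs : HasSum (fun n : ℕ => ((n.factorial : ℝ)⁻¹) * s ^ n) (Real.exp s) := by
    have := NormedSpace.exp_series_hasSum_exp' (𝕂 := ℝ) (𝔸 := ℝ) s
    rw [Real.exp_eq_exp_ℝ]; simpa using this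
  have h2 := (hs.smul_const P).add (hasSum_ite_eq (0 : ℕ) (1 - P))
  have hP : ∀ n : ℕ, n ≠ 0 → P ^ n = P := by
    intro n hn
    induction n with
    | zero => exact absurd rfl hn
    | succ n ih =>
      by_cases h0 : n = 0
      · subst h0; simp
      · rw [pow_succ, ih h0, h]
  have := h1.unique (h2.congr_fun ?_)
  · rw [this, sub_smul, one_smul]; abel
  · intro n
    by_cases h0 : n = 0
    · subst h0; simp
    · rw [smul_pow, hP n h0]; simp [h0, smul_smul]

set_option linter.unusedSectionVars false
set_option linter.deprecated false
set_option linter.unusedSimpArgs false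
variable {Ω : Type} [Fintype Ω] [DecidableEq Ω]

/-- insertion operator -/
noncomputable def insOp (ω : Ω) : (Finset Ω → ℝ) →L[ℝ] (Finset Ω → ℝ) :=
  ContinuousLinearMap.pi fun S => ContinuousLinearMap.proj (insert ω S)

theorem insOp_apply (ω : Ω) (F : Finset Ω → ℝ) (S : Finset Ω) : insOp ω F S = F (insert ω S) := rfl

theorem insOp_idem (ω : Ω) : insOp ω * insOp ω = insOp (Ω := Ω) ω := by
  ext F S; simp [insOp_apply, ContinuousLinearMap.mul_apply]

theorem one_add_insOp (c : ℝ) (ω : Ω) (F : Finset Ω → ℝ) (S : Finset Ω) :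
    (1 + c • insOp ω : (Finset Ω → ℝ) →L[ℝ] (Finset Ω → ℝ)) F S = F S + c * F (insert ω S) := rfl

theorem insOp_comm (ω ω' : Ω) : Commute (insOp ω) (insOp (Ω := Ω) ω') := by
  change _ = _
  ext F S; simp [insOp_apply, ContinuousLinearMap.mul_apply, Finset.insert_comm]

theorem exp_insOp (s : ℝ) (D : Finset Ω) : ∀ (F : Finset Ω → ℝ) (S : Finset Ω),
    (NormedSpace.exp (s • ∑ ω ∈ D, insOp ω) : (Finset Ω → ℝ) →L[ℝ] (Finset Ω → ℝ)) F S =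
      ∑ X ∈ D.powerset, (Real.exp s - 1) ^ X.card * F (S ∪ X) := by
  induction D using Finset.induction_on with
  | empty => intro F S; simp
  | insert ω D hω ih =>
    intro F S
    rw [Finset.sum_insert hω, smul_add, exp_add_real, exp_idem (insOp_idem ω)]
    · rw [ContinuousLinearMap.mul_apply, one_add_insOp, ih, ih, Finset.sum_powerset_insert hω,
        Finset.mul_sum]
      congr 1
      apply Finset.sum_congr rfl
      intro X hX
      have hX' : ω ∉ X := fun h => hω (Finset.mem_powerset.1 hX h)
      rw [Finset.card_insert_of_notMem hX', pow_succ, Finset.union_insert, Finset.insert_union]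
      ring
    · apply Commute.smul_left
      apply Commute.smul_right
      exact Commute.sum_right _ _ _ fun i _ => insOp_comm _ _

/-- averaging over a uniformly chosen inserted cell -/
noncomputable def av (F : Finset Ω → ℝ) (S : Finset Ω) : ℝ :=
  (∑ ω, F (insert ω S)) / Fintype.card Ω

theorem insOp_pow [Nonempty Ω] (F : Finset Ω → ℝ) (k : ℕ) :
    ∀ S, ((∑ ω : Ω, insOp ω) ^ k : (Finset Ω → ℝ) →L[ℝ] (Finset Ω → ℝ)) F S =
      (Fintype.card Ω : ℝ) ^ k * av^[k] F S := by
  have hN : (Fintype.card Ω : ℝ) ≠ 0 := by simp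
  induction k with
  | zero => intro S; simp
  | succ k ih =>
    intro S
    rw [pow_succ', ContinuousLinearMap.mul_apply, ContinuousLinearMap.sum_apply, Finset.sum_apply,
      Function.iterate_succ_apply']
    simp only [insOp_apply, ih]
    rw [← Finset.mul_sum, av, pow_succ]
    field_simp

theorem pois_hasSum [Nonempty Ω] (s : ℝ) (F : Finset Ω → ℝ) (S : Finset Ω) :
    HasSum (fun k : ℕ => ((k.factorial : ℝ)⁻¹) * (s * Fintype.card Ω) ^ k * av^[k] F S)
      (∑ X : Finset Ω, (Real.exp s - 1) ^ X.card * F (S ∪ X)) := by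
  have h1 := NormedSpace.exp_series_hasSum_exp' (𝕂 := ℝ)
    (s • ∑ ω : Ω, insOp ω : (Finset Ω → ℝ) →L[ℝ] (Finset Ω → ℝ))
  have h2 := h1.mapL (ContinuousLinearMap.apply ℝ (Finset Ω → ℝ) F)
  have h3 := h2.mapL (ContinuousLinearMap.proj (R := ℝ) (φ := fun _ : Finset Ω => ℝ) S)
  have e := exp_insOp s Finset.univ F S
  rw [Finset.powerset_univ] at e
  rw [← e]
  refine h3.congr_fun fun k => ?_
  have : (ContinuousLinearMap.proj (R := ℝ) (φ := fun _ : Finset Ω => ℝ) S)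
      ((ContinuousLinearMap.apply ℝ (Finset Ω → ℝ) F)
        (((k.factorial : ℝ)⁻¹) • (s • ∑ ω : Ω, insOp ω) ^ k)) =
      (k.factorial : ℝ)⁻¹ * (s ^ k * ((∑ ω : Ω, insOp ω) ^ k :
        (Finset Ω → ℝ) →L[ℝ] (Finset Ω → ℝ)) F S) := by
    rw [smul_pow]; rfl
  rw [this, insOp_pow, mul_pow]; ring

/-- monotone functionals -/
def FMono (F : Finset Ω → ℝ) : Prop := ∀ S ω, F S ≤ F (insert ω S)

theorem FMono.av {F : Finset Ω → ℝ} (h : FMono F) : FMono (av F) := by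
  intro S ω
  unfold _root_.av
  apply div_le_div_of_nonneg_right _ (Nat.cast_nonneg _)
  apply Finset.sum_le_sum
  intro i _
  rw [Finset.insert_comm]; exact h _ _

theorem FMono.iter {F : Finset Ω → ℝ} (h : FMono F) (k : ℕ) : FMono (_root_.av^[k] F) := by
  induction k with
  | zero => exact h
  | succ k ih => rw [Function.iterate_succ_apply']; exact ih.av

theorem FMono.le_av [Nonempty Ω] {F : Finset Ω → ℝ} (h : FMono F) (S : Finset Ω) :
    F S ≤ _root_.av F S := by
  have hN : (0 : ℝ) < Fintype.card Ω := by exact_mod_cast Fintype.card_pos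
  unfold _root_.av
  rw [le_div_iff₀ hN]
  calc F S * Fintype.card Ω = ∑ _ω : Ω, F S := by simp [mul_comm]
    _ ≤ _ := Finset.sum_le_sum fun ω _ => h S ω

theorem FMono.iter_mono [Nonempty Ω] {F : Finset Ω → ℝ} (h : FMono F) (S : Finset Ω) :
    Monotone fun k : ℕ => _root_.av^[k] F S := by
  apply monotone_nat_of_le_succ
  intro k
  rw [Function.iterate_succ_apply']
  exact (h.iter k).le_av S

theorem av_mem [Nonempty Ω] {F : Finset Ω → ℝ} {a b : ℝ} (h : ∀ S, a ≤ F S ∧ F S ≤ b) (k : ℕ) :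
    ∀ S, a ≤ av^[k] F S ∧ av^[k] F S ≤ b := by
  have hN : (0 : ℝ) < Fintype.card Ω := by exact_mod_cast Fintype.card_pos
  induction k with
  | zero => exact h
  | succ k ih =>
    intro S
    rw [Function.iterate_succ_apply', av, le_div_iff₀ hN, div_le_iff₀ hN]
    constructor
    · calc a * Fintype.card Ω = ∑ _ω : Ω, a := by simp [mul_comm]
        _ ≤ _ := Finset.sum_le_sum fun ω _ => (ih _).1
    · calc _ ≤ ∑ _ω : Ω, b := Finset.sum_le_sum fun ω _ => (ih _).2
        _ = _ := by simp [mul_comm]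

theorem hasSum_exp_aux (l : ℝ) :
    HasSum (fun k : ℕ => ((k.factorial : ℝ)⁻¹) * l ^ k) (Real.exp l) := by
  have := NormedSpace.exp_series_hasSum_exp' (𝕂 := ℝ) (𝔸 := ℝ) l
  rw [Real.exp_eq_exp_ℝ]; simpa using this

theorem pois_up [Nonempty Ω] (s : ℝ) (hs : 0 ≤ s) (F : Finset Ω → ℝ) (hF : FMono F)
    (h01 : ∀ S, 0 ≤ F S ∧ F S ≤ 1) (k : ℕ) (θ : ℝ) (hθ : 0 < θ) (hθ1 : θ ≤ 1) (b : ℝ)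
    (hb : b = Real.exp (-(s * Fintype.card Ω)) *
      ∑ X : Finset Ω, (Real.exp s - 1) ^ X.card * F X) :
    av^[k] F ∅ * (1 - (θ ^ k)⁻¹ * Real.exp (s * Fintype.card Ω * (θ - 1))) ≤ b := by
  have h1 := pois_hasSum s F ∅
  simp only [Finset.empty_union] at h1
  set l := s * Fintype.card Ω with hl
  have hl0 : 0 ≤ l := by positivity
  have h2 := ((hasSum_exp_aux l).sub ((hasSum_exp_aux (l * θ)).mul_left (θ ^ k)⁻¹)).mul_left
    (av^[k] F ∅)
  have h3 := hasSum_le ?_ h2 h1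
  · have h4 := mul_le_mul_of_nonneg_left h3 (Real.exp_pos (-l)).le
    rw [hb]
    refine le_trans (le_of_eq ?_) h4
    have e1 : Real.exp (l * θ) = Real.exp l * Real.exp (l * (θ - 1)) := by
      rw [← Real.exp_add]; congr 1; ring
    have e2 : Real.exp (-l) * Real.exp l = 1 := by rw [← Real.exp_add]; simp
    rw [e1]
    linear_combination (-(av^[k] F ∅ * (1 - (θ ^ k)⁻¹ * Real.exp (l * (θ - 1))))) * e2
  · intro j
    have hj : 0 ≤ ((j.factorial : ℝ)⁻¹) * l ^ j := by positivity
    have key : av^[k] F ∅ * (1 - (θ ^ k)⁻¹ * θ ^ j) ≤ av^[j] F ∅ := by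
      have ak := (av_mem h01 k ∅).1
      have aj := (av_mem h01 j ∅).1
      rcases le_total k j with h | h
      · have m := hF.iter_mono ∅ h
        have : 0 ≤ (θ ^ k)⁻¹ * θ ^ j := by positivity
        simp only at m
        nlinarith
      · have : 1 ≤ (θ ^ k)⁻¹ * θ ^ j := by
          rw [inv_mul_eq_div, one_le_div (by positivity)]
          exact pow_le_pow_of_le_one hθ.le hθ1 h
        nlinarith
    have := mul_le_mul_of_nonneg_left key hj
    rw [mul_pow l θ j]
    linarith

theorem pois_low [Nonempty Ω] (s : ℝ) (hs : 0 ≤ s) (F : Finset Ω → ℝ) (hF : FMono F)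
    (h01 : ∀ S, 0 ≤ F S ∧ F S ≤ 1) (k : ℕ) (θ : ℝ) (hθ1 : 1 ≤ θ) (b : ℝ)
    (hb : b = Real.exp (-(s * Fintype.card Ω)) *
      ∑ X : Finset Ω, (Real.exp s - 1) ^ X.card * F X) :
    (1 - av^[k] F ∅) * (1 - (θ ^ k)⁻¹ * Real.exp (s * Fintype.card Ω * (θ - 1))) ≤ 1 - b := by
  have hθ : 0 < θ := by linarith
  have h1 := pois_hasSum s F ∅
  simp only [Finset.empty_union] at h1
  set l := s * Fintype.card Ω with hl
  have hl0 : 0 ≤ l := by positivity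
  have h2 := ((hasSum_exp_aux l).sub ((hasSum_exp_aux (l * θ)).mul_left (θ ^ k)⁻¹)).mul_left
    (1 - av^[k] F ∅)
  have h3 := hasSum_le ?_ h2 ((hasSum_exp_aux l).sub h1)
  · have h4 := mul_le_mul_of_nonneg_left h3 (Real.exp_pos (-l)).le
    have e2 : Real.exp (-l) * Real.exp l = 1 := by rw [← Real.exp_add]; simp
    rw [hb]
    rw [mul_sub (Real.exp (-l)) (Real.exp l), e2] at h4
    refine le_trans (le_of_eq ?_) h4
    have e1 : Real.exp (l * θ) = Real.exp l * Real.exp (l * (θ - 1)) := by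
      rw [← Real.exp_add]; congr 1; ring
    rw [e1]
    linear_combination (-((1 - av^[k] F ∅) * (1 - (θ ^ k)⁻¹ * Real.exp (l * (θ - 1))))) * e2
  · intro j
    have hj : 0 ≤ ((j.factorial : ℝ)⁻¹) * l ^ j := by positivity
    have key : (1 - av^[k] F ∅) * (1 - (θ ^ k)⁻¹ * θ ^ j) ≤ 1 - av^[j] F ∅ := by
      have ak := (av_mem h01 k ∅).2
      have aj := (av_mem h01 j ∅).2
      rcases le_total j k with h | h
      · have m := hF.iter_mono ∅ h
        have : 0 ≤ (θ ^ k)⁻¹ * θ ^ j := by positivity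
        simp only at m
        nlinarith
      · have : 1 ≤ (θ ^ k)⁻¹ * θ ^ j := by
          rw [inv_mul_eq_div, one_le_div (by positivity)]
          exact pow_le_pow_right₀ hθ1 h
        nlinarith
    have := mul_le_mul_of_nonneg_left key hj
    rw [mul_pow l θ j]
    linarith

end poisson

/-! ### The Bernoulli field as a sum over subsets -/
open Ex

theorem row_sum (p u : ℝ) (h0 : 0 ≤ p) (h1 : p ≤ 1) (hu : p = (1 - p) * u) (m : ℕ)
    (g : (ℕ → Bool) → ℝ) :
    (iid (ber p h0 h1) false m).toFun g =
      (1 - p) ^ m * ∑ Y ∈ (Finset.range m).powerset, u ^ Y.card * g (fun i => decide (i ∈ Y)) := by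
  induction m generalizing g with
  | zero => simp [iid_zero]
  | succ m ih =>
    rw [iid_succ, ih, Finset.range_add_one, Finset.sum_powerset_insert Finset.notMem_range_self,
      pow_succ, mul_assoc, ← Finset.sum_add_distrib, Finset.mul_sum _ _ (1 - p)]
    congr 1
    apply Finset.sum_congr rfl
    intro Y hY
    have hm : m ∉ Y := fun h => Finset.notMem_range_self (Finset.mem_powerset.1 hY h)
    have e1 : Function.update (fun i => decide (i ∈ Y)) m true =
        fun i => decide (i ∈ insert m Y) := by
      funext i; by_cases h : i = m
      · subst h; simp
      · simp [h]
    have e2 : Function.update (fun i => decide (i ∈ Y)) m false = fun i => decide (i ∈ Y) := by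
      funext i; by_cases h : i = m
      · subst h; simp [hm]
      · simp [h]
    rw [ber_apply, e1, e2, Finset.card_insert_of_notMem hm, pow_succ]
    generalize g (fun i => decide (i ∈ insert m Y)) = a
    linear_combination (u ^ Y.card * a) * hu

/-- indicator field -/
def fieldOf (X : Finset (ℕ × ℕ)) : ℕ → ℕ → Bool := fun j i => decide ((i, j) ∈ X)

theorem fld_sum (p u : ℝ) (h0 : 0 ≤ p) (h1 : p ≤ 1) (hu : p = (1 - p) * u) (M n : ℕ)
    (f : (ℕ → ℕ → Bool) → ℝ) :
    (iid (iid (ber p h0 h1) false M) (fun _ => false) n).toFun f =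
      (1 - p) ^ (M * n) * ∑ X ∈ (Finset.range M ×ˢ Finset.range n).powerset,
        u ^ X.card * f (fieldOf X) := by
  induction n generalizing f with
  | zero =>
    simp only [iid_zero, mul_zero, pow_zero, Finset.range_zero, Finset.product_empty,
      Finset.powerset_empty, Finset.sum_singleton, Finset.card_empty, one_mul]
    congr 1
  | succ n ih =>
    rw [iid_succ, ih]
    simp only [row_sum p u h0 h1 hu]
    have e : (1 - p) ^ (M * (n + 1)) = (1 - p) ^ (M * n) * (1 - p) ^ M := by
      rw [← pow_add]; ring
    rw [e, mul_assoc]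
    congr 1
    rw [Finset.mul_sum]
    simp only [Finset.mul_sum]
    rw [← Finset.sum_product']
    refine Finset.sum_nbij' (fun Q => Q.1 ∪ Q.2 ×ˢ {n})
      (fun Z => (Z.filter (fun z => z.2 < n), (Z.filter (fun z => z.2 = n)).image Prod.fst))
      ?_ ?_ ?_ ?_ ?_
    · rintro ⟨X, Y⟩ h
      simp only [Finset.mem_product, Finset.mem_powerset] at h
      rw [Finset.mem_powerset]
      intro z hz
      rcases Finset.mem_union.1 hz with hz | hz
      · have := Finset.mem_product.1 (h.1 hz)
        rw [Finset.mem_range, Finset.mem_range] at this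
        rw [Finset.mem_product, Finset.mem_range, Finset.mem_range]; omega
      · have hz := Finset.mem_product.1 hz
        have h1 := Finset.mem_range.1 (h.2 hz.1)
        have h2 := Finset.mem_singleton.1 hz.2
        rw [Finset.mem_product, Finset.mem_range, Finset.mem_range]; omega
    · intro Z hZ
      rw [Finset.mem_powerset] at hZ
      rw [Finset.mem_product, Finset.mem_powerset, Finset.mem_powerset]
      constructor
      · intro z hz
        rw [Finset.mem_filter] at hz
        have := Finset.mem_product.1 (hZ hz.1)
        rw [Finset.mem_product, Finset.mem_range, Finset.mem_range]
        exact ⟨Finset.mem_range.1 this.1, hz.2⟩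
      · intro i hi
        obtain ⟨z, hz, rfl⟩ := Finset.mem_image.1 hi
        exact (Finset.mem_product.1 (hZ (Finset.mem_filter.1 hz).1)).1
    · rintro ⟨X, Y⟩ h
      simp only [Finset.mem_product, Finset.mem_powerset] at h
      have hX : ∀ z ∈ X, z.2 < n := fun z hz =>
        Finset.mem_range.1 (Finset.mem_product.1 (h.1 hz)).2
      apply Prod.ext
      · ext z
        simp only [Finset.mem_filter, Finset.mem_union, Finset.mem_product, Finset.mem_singleton]
        constructor
        · rintro ⟨h1 | h1, h2⟩
          · exact h1
          · omega
        · exact fun h => ⟨Or.inl h, hX z h⟩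
      · ext i
        simp only [Finset.mem_filter, Finset.mem_union, Finset.mem_product, Finset.mem_singleton,
          Finset.mem_image]
        constructor
        · rintro ⟨z, ⟨h1 | h1, h2⟩, rfl⟩
          · exact absurd (hX z h1) (by omega)
          · exact h1.1
        · exact fun h => ⟨(i, n), ⟨Or.inr ⟨h, rfl⟩, rfl⟩, rfl⟩
    · intro Z hZ
      rw [Finset.mem_powerset] at hZ
      ext ⟨i, j⟩
      simp only [Finset.mem_filter, Finset.mem_union, Finset.mem_product, Finset.mem_singleton,
          Finset.mem_image]
      constructor
      · rintro (h | ⟨⟨z, ⟨h1, h2⟩, h3⟩, h4⟩)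
        · exact h.1
        · obtain ⟨a, b⟩ := z
          simp only at h2 h3
          rw [h4, ← h3, ← h2]; exact h1
      · intro h
        have := Finset.mem_range.1 (Finset.mem_product.1 (hZ h)).2
        simp only at this
        rcases Nat.lt_succ_iff_lt_or_eq.1 this with h' | h'
        · exact Or.inl ⟨h, h'⟩
        · exact Or.inr ⟨⟨(i, j), ⟨h, h'⟩, rfl⟩, h'⟩
    · rintro ⟨X, Y⟩ h
      simp only [Finset.mem_product, Finset.mem_powerset] at h
      have hX : ∀ z ∈ X, z.2 < n := fun z hz =>
        Finset.mem_range.1 (Finset.mem_product.1 (h.1 hz)).2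
      have hd : Disjoint X (Y ×ˢ {n}) := by
        rw [Finset.disjoint_left]
        intro z hz hz'
        have := hX z hz
        have := Finset.mem_singleton.1 (Finset.mem_product.1 hz').2
        omega
      have e2 : Function.update (fieldOf X) n (fun i => decide (i ∈ Y)) =
          fieldOf (X ∪ Y ×ˢ {n}) := by
        funext j i
        by_cases hj : j = n
        · subst hj
          have : (i, j) ∉ X := fun h => absurd (hX _ h) (lt_irrefl _)
          simp [fieldOf, this]
        · simp [fieldOf, hj]; intro _ h; exact absurd h.symm hj
      simp only [e2]
      rw [Finset.card_union_of_disjoint hd, Finset.card_product, Finset.card_singleton, mul_one,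
        pow_add]
      ring

/-- embedding of cells -/
def cellEmb (M : ℕ) : Fin M × Fin M ↪ ℕ × ℕ := Fin.valEmbedding.prodMap Fin.valEmbedding

theorem fld_sum_fin (p u : ℝ) (h0 : 0 ≤ p) (h1 : p ≤ 1) (hu : p = (1 - p) * u) (M : ℕ)
    (f : (ℕ → ℕ → Bool) → ℝ) :
    (fld p h0 h1 M).toFun f = (1 - p) ^ (M * M) * ∑ X : Finset (Fin M × Fin M),
        u ^ X.card * f (fieldOf (X.map (cellEmb M))) := by
  rw [fld, fld_sum p u h0 h1 hu]
  congr 1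
  symm
  refine Finset.sum_nbij (fun X => X.map (cellEmb M)) ?_ ?_ ?_ ?_
  · intro X _
    rw [Finset.mem_powerset]
    intro z hz
    obtain ⟨w, _, rfl⟩ := Finset.mem_map.1 hz
    rw [Finset.mem_product, Finset.mem_range, Finset.mem_range]
    exact ⟨w.1.2, w.2.2⟩
  · intro X _ Y _ h
    exact Finset.map_injective _ h
  · intro Z hZ
    have hZ := Finset.mem_powerset.1 (Finset.mem_coe.1 hZ)
    refine ⟨Finset.univ.filter (fun w => cellEmb M w ∈ Z), by simp, ?_⟩
    ext z
    simp only [Finset.mem_map, Finset.mem_filter, Finset.mem_univ, true_and]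
    constructor
    · rintro ⟨w, h, rfl⟩; exact h
    · intro h
      have := Finset.mem_product.1 (hZ h)
      refine ⟨(⟨z.1, Finset.mem_range.1 this.1⟩, ⟨z.2, Finset.mem_range.1 this.2⟩), ?_, ?_⟩
      · exact h
      · rfl
  · intro X _
    simp only [Finset.card_map]

theorem fld_pois (l : ℝ) (M : ℕ) (h0 : 0 ≤ pm l M) (h1 : pm l M ≤ 1)
    (f : (ℕ → ℕ → Bool) → ℝ) :
    (fld (pm l M) h0 h1 M).toFun f =
      Real.exp (-(l / (M : ℝ) ^ 2 * Fintype.card (Fin M × Fin M))) *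
        ∑ X : Finset (Fin M × Fin M), (Real.exp (l / (M : ℝ) ^ 2) - 1) ^ X.card *
          f (fieldOf (X.map (cellEmb M))) := by
  have he : Real.exp (-(l / (M : ℝ) ^ 2)) * Real.exp (l / (M : ℝ) ^ 2) = 1 := by
    rw [← Real.exp_add]; simp
  rw [fld_sum_fin (pm l M) (Real.exp (l / (M : ℝ) ^ 2) - 1) h0 h1]
  · congr 1
    have : 1 - pm l M = Real.exp (-(l / (M : ℝ) ^ 2)) := by unfold pm; ring
    rw [this, ← Real.exp_nat_mul]
    congr 1
    simp only [Fintype.card_prod, Fintype.card_fin]; push_cast; ring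
  · unfold pm; linear_combination -he

/-! ### Transfer to weighted samples -/
section transfer
variable {Ω : Type} [Fintype Ω] [DecidableEq Ω]

/-- binomial tail -/
noncomputable def binR (c : ℝ) : ℕ → ℕ → ℝ
  | _, 0 => 1
  | 0, _ + 1 => 0
  | n + 1, k + 1 => c * binR c n k + (1 - c) * binR c n (k + 1)

theorem binR_mem {c : ℝ} (h0 : 0 ≤ c) (h1 : c ≤ 1) (n : ℕ) :
    ∀ k, 0 ≤ binR c n k ∧ binR c n k ≤ 1 := by
  induction n with
  | zero => intro k; cases k <;> simp [binR]
  | succ n ih =>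
    intro k
    cases k with
    | zero => simp [binR]
    | succ k =>
      simp only [binR]
      obtain ⟨a, b⟩ := ih k
      obtain ⟨d, e⟩ := ih (k + 1)
      constructor
      · have := sub_nonneg.2 h1
        positivity
      · nlinarith

theorem binR_chernoff {c θ : ℝ} (h0 : 0 ≤ c) (h1 : c ≤ 1) (hθ : 0 < θ) (hθ1 : θ ≤ 1) (n : ℕ) :
    ∀ k, 1 - binR c n k ≤ (θ ^ k)⁻¹ * (1 - c + c * θ) ^ n := by
  have hX : 0 ≤ 1 - c + c * θ := by have := sub_nonneg.2 h1; positivity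
  induction n with
  | zero =>
    intro k; cases k with
    | zero => simp [binR]
    | succ k =>
      simp only [binR, pow_zero, mul_one, sub_zero]
      exact (one_le_inv₀ (by positivity)).2 (pow_le_one₀ hθ.le hθ1)
  | succ n ih =>
    intro k; cases k with
    | zero => simp only [binR, pow_zero]; simp; positivity
    | succ k =>
      simp only [binR]
      have a := mul_le_mul_of_nonneg_left (ih k) h0
      have b := mul_le_mul_of_nonneg_left (ih (k + 1)) (sub_nonneg.2 h1)
      have e : (θ ^ k)⁻¹ = (θ ^ (k + 1))⁻¹ * θ := by rw [pow_succ]; field_simp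
      rw [e] at a
      rw [pow_succ (1 - c + c * θ) n]
      linarith

/-- lazy averaging -/
noncomputable def lav (c : ℝ) (F : Finset Ω → ℝ) (S : Finset Ω) : ℝ := c * av F S + (1 - c) * F S

theorem av_le_av {F G : Finset Ω → ℝ} (h : ∀ S, F S ≤ G S) (S : Finset Ω) : av F S ≤ av G S := by
  unfold av
  exact div_le_div_of_nonneg_right (Finset.sum_le_sum fun _ _ => h _) (Nat.cast_nonneg _)

theorem av_mul (a : ℝ) (F : Finset Ω → ℝ) (S : Finset Ω) : av (fun S => a * F S) S = a * av F S := by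
  unfold av; rw [← Finset.mul_sum]; ring

theorem lav_mono {c : ℝ} (h0 : 0 ≤ c) (h1 : c ≤ 1) {F : Finset Ω → ℝ} (hF : FMono F) (n : ℕ) :
    FMono ((lav c)^[n] F) := by
  induction n with
  | zero => exact hF
  | succ n ih =>
    rw [Function.iterate_succ_apply']
    intro S ω
    unfold lav
    have := mul_le_mul_of_nonneg_left (ih.av S ω) h0
    have := mul_le_mul_of_nonneg_left (ih S ω) (sub_nonneg.2 h1)
    unfold lav at *
    linarith

theorem lav_ge [Nonempty Ω] {c : ℝ} (h0 : 0 ≤ c) (h1 : c ≤ 1) {F : Finset Ω → ℝ} (hF : FMono F)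
    (hF0 : ∀ S, 0 ≤ F S)
    (n : ℕ) : ∀ k S, binR c n k * av^[k] F S ≤ (lav c)^[n] F S := by
  induction n with
  | zero =>
    intro k S; cases k with
    | zero => simp [binR]
    | succ k =>
      simp only [binR, zero_mul, Function.iterate_zero, id]
      exact hF0 S
  | succ n ih =>
    intro k S
    rw [Function.iterate_succ_apply' (lav c)]
    have hm := lav_mono h0 h1 hF n
    unfold lav
    cases k with
    | zero =>
      have a := ih 0 S
      have b := hm.le_av S
      simp only [binR, one_mul, Function.iterate_zero, id] at *
      have := mul_le_mul_of_nonneg_left b h0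
      unfold lav at *
      linarith
    | succ k =>
      simp only [binR]
      have a := mul_le_mul_of_nonneg_left (av_le_av (ih k) S) h0
      have b := mul_le_mul_of_nonneg_left (ih (k + 1) S) (sub_nonneg.2 h1)
      rw [av_mul] at a
      rw [Function.iterate_succ_apply'] at b ⊢
      unfold lav at *
      linarith

/-- total weight -/
def wtot {n : ℕ} (w : (Fin n → Ω) → ℝ) : ℝ := ∑ z, w z

/-- weighted sum of a functional of the sample -/
def wsum {n : ℕ} (w : (Fin n → Ω) → ℝ) (F : Finset Ω → ℝ) (S : Finset Ω) : ℝ :=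
  ∑ z, w z * F (S ∪ Finset.univ.image z)

/-- ratio property -/
def Ratio (c : ℝ) {n : ℕ} (w : (Fin n → Ω) → ℝ) : Prop :=
  ∀ z i y, c * w z ≤ w (Function.update z i y)

theorem sum_cons {n : ℕ} (g : (Fin (n + 1) → Ω) → ℝ) :
    ∑ z, g z = ∑ ω : Ω, ∑ z : Fin n → Ω, g (Fin.cons ω z) := by
  rw [← Fintype.sum_prod_type', ← (Fin.consEquiv (fun _ => Ω)).sum_comp]
  rfl

theorem image_cons {n : ℕ} (ω : Ω) (z : Fin n → Ω) (S : Finset Ω) :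
    S ∪ Finset.univ.image (Fin.cons ω z : Fin (n + 1) → Ω) = insert ω S ∪ Finset.univ.image z := by
  ext x
  simp only [Finset.mem_union, Finset.mem_image, Finset.mem_univ, true_and, Finset.mem_insert,
    Fin.exists_fin_succ, Fin.cons_zero, Fin.cons_succ]
  tauto

theorem wtot_succ {n : ℕ} (w : (Fin (n + 1) → Ω) → ℝ) :
    wtot w = ∑ ω, wtot (fun z => w (Fin.cons ω z)) := sum_cons w

theorem wsum_succ {n : ℕ} (w : (Fin (n + 1) → Ω) → ℝ) (F : Finset Ω → ℝ) (S : Finset Ω) :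
    wsum w F S = ∑ ω, wsum (fun z => w (Fin.cons ω z)) F (insert ω S) := by
  unfold wsum
  rw [sum_cons]
  simp only [image_cons]

theorem Ratio.slice {c : ℝ} {n : ℕ} {w : (Fin (n + 1) → Ω) → ℝ} (h : Ratio c w) (ω : Ω) :
    Ratio c (fun z => w (Fin.cons ω z)) := by
  intro z i y
  have := h (Fin.cons ω z) i.succ y
  rwa [← Fin.cons_update] at this

theorem Ratio.wtot_le {c : ℝ} {n : ℕ} {w : (Fin (n + 1) → Ω) → ℝ} (h : Ratio c w) (ω ω' : Ω) :
    c * wtot (fun z => w (Fin.cons ω z)) ≤ wtot (fun z => w (Fin.cons ω' z)) := by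
  unfold wtot
  rw [Finset.mul_sum]
  apply Finset.sum_le_sum
  intro z _
  have := h (Fin.cons ω z) 0 ω'
  rwa [Fin.update_cons_zero] at this

theorem wsum_mono {n : ℕ} {w : (Fin n → Ω) → ℝ} (hw : ∀ z, 0 < w z) {F : Finset Ω → ℝ}
    (hF : FMono F) (S : Finset Ω) (ω : Ω) : wsum w F S ≤ wsum w F (insert ω S) := by
  apply Finset.sum_le_sum
  intro z _
  rw [Finset.insert_union]
  exact mul_le_mul_of_nonneg_left (hF _ _) (hw z).le

theorem transfer_lower [Nonempty Ω] {c : ℝ} (h0 : 0 ≤ c) (h1 : c ≤ 1) {F : Finset Ω → ℝ}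
    (hF : FMono F) {n : ℕ} : ∀ (w : (Fin n → Ω) → ℝ), (∀ z, 0 < w z) → Ratio c w →
    ∀ S, wtot w * (lav c)^[n] F S ≤ wsum w F S := by
  have hN : (0 : ℝ) < Fintype.card Ω := by exact_mod_cast Fintype.card_pos
  induction n with
  | zero => intro w hw hr S; simp [wtot, wsum]
  | succ n ih =>
    intro w hw hr S
    set G := (lav c)^[n] F with hG
    have hGm : FMono G := lav_mono h0 h1 hF n
    rw [Function.iterate_succ_apply' (lav c), ← hG, wsum_succ]
    set W := wtot w with hW
    set Wo : Ω → ℝ := fun ω => wtot (fun z => w (Fin.cons ω z)) with hWo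
    have hsum : W = ∑ ω, Wo ω := wtot_succ w
    have hge : ∀ ω, c * W / Fintype.card Ω ≤ Wo ω := by
      intro ω
      rw [div_le_iff₀ hN, hsum, Finset.mul_sum]
      calc _ ≤ ∑ _ω' : Ω, Wo ω := Finset.sum_le_sum fun ω' _ => hr.wtot_le ω' ω
        _ = _ := by simp [mul_comm]
    calc W * lav c G S = ∑ ω, c * W / Fintype.card Ω * G (insert ω S) +
          ∑ ω, (Wo ω - c * W / Fintype.card Ω) * G S := by
            rw [← Finset.sum_mul, ← Finset.mul_sum, Finset.sum_sub_distrib, ← hsum]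
            simp only [Finset.sum_const, Finset.card_univ, nsmul_eq_mul]
            unfold lav av
            field_simp
      _ ≤ ∑ ω, c * W / Fintype.card Ω * G (insert ω S) +
          ∑ ω, (Wo ω - c * W / Fintype.card Ω) * G (insert ω S) := by
            gcongr with ω _
            · exact sub_nonneg.2 (hge ω)
            · exact hGm S ω
      _ = ∑ ω, Wo ω * G (insert ω S) := by
            rw [← Finset.sum_add_distrib]
            exact Finset.sum_congr rfl fun ω _ => by ring
      _ ≤ _ := Finset.sum_le_sum fun ω _ => ih _ (fun z => hw _) (hr.slice ω) _

theorem transfer_upper [Nonempty Ω] {c : ℝ} (h0 : 0 ≤ c) (h1 : c ≤ 1) {F : Finset Ω → ℝ}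
    (hF : FMono F) (hF0 : ∀ S, 0 ≤ F S) (N : ℕ) : ∀ (n : ℕ) (w : (Fin n → Ω) → ℝ),
    (∀ z, 0 < w z) → Ratio c w → ∀ S, binR c N n * wsum w F S ≤ wtot w * av^[N] F S := by
  have hN : (0 : ℝ) < Fintype.card Ω := by exact_mod_cast Fintype.card_pos
  induction N with
  | zero =>
    intro n w hw hr S
    cases n with
    | zero => simp [wtot, wsum, binR]
    | succ n =>
      simp only [binR, zero_mul, Function.iterate_zero, id]
      exact mul_nonneg (Finset.sum_nonneg fun z _ => (hw z).le) (hF0 S)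
  | succ N ih =>
    intro n w hw hr S
    cases n with
    | zero =>
      have := hF.iter_mono S (Nat.zero_le (N + 1))
      simp only [Function.iterate_zero, id] at this
      simp only [wtot, wsum, binR, Finset.univ_unique, Finset.sum_singleton, one_mul]
      simp
      exact mul_le_mul_of_nonneg_left this (hw _).le
    | succ n =>
      have hWpos : 0 < wtot w := Finset.sum_pos (fun z _ => hw z) Finset.univ_nonempty
      have IH1 := fun ω => ih (n + 1) w hw hr (insert ω S)
      have IH2 := fun ω => ih n _ (fun z => hw (Fin.cons ω z)) (hr.slice ω) (insert ω S)
      have hE := wsum_succ w F S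
      have hEm := fun ω => wsum_mono hw hF S ω
      have hsum := wtot_succ w
      have hle : ∀ ω, c * wtot (fun z => w (Fin.cons ω z)) ≤ wtot w / Fintype.card Ω := by
        intro ω
        rw [le_div_iff₀ hN, hsum]
        calc _ = ∑ _ω' : Ω, c * wtot (fun z => w (Fin.cons ω z)) := by simp [mul_comm]
          _ ≤ _ := Finset.sum_le_sum fun ω' _ => hr.wtot_le ω ω'
      simp only [binR]
      rw [Function.iterate_succ_apply' av, av]
      set G := av^[N] F with hG
      set W := wtot w with hW
      set E := wsum w F S with hEd
      have hR := (binR_mem h0 h1 N (n + 1)).1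
      set R1 := binR c N (n + 1)
      set R0 := binR c N n
      have g1 : ∀ ω, R1 * E / W ≤ G (insert ω S) := by
        intro ω
        rw [div_le_iff₀ hWpos]
        have := mul_le_mul_of_nonneg_left (hEm ω) hR
        linarith [IH1 ω]
      calc (c * R0 + (1 - c) * R1) * E
          = ∑ ω, (c * (R0 * wsum (fun z => w (Fin.cons ω z)) F (insert ω S)) +
            (W / Fintype.card Ω - c * wtot (fun z => w (Fin.cons ω z))) * (R1 * E / W)) := by
            rw [Finset.sum_add_distrib, ← Finset.mul_sum, ← Finset.mul_sum, ← hE,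
              ← Finset.sum_mul, Finset.sum_sub_distrib, ← Finset.mul_sum, ← hsum]
            simp only [Finset.sum_const, Finset.card_univ, nsmul_eq_mul]
            field_simp
        _ ≤ ∑ ω, (c * (wtot (fun z => w (Fin.cons ω z)) * G (insert ω S)) +
            (W / Fintype.card Ω - c * wtot (fun z => w (Fin.cons ω z))) * G (insert ω S)) := by
            apply Finset.sum_le_sum
            intro ω _
            exact add_le_add (mul_le_mul_of_nonneg_left (IH2 ω) h0)
              (mul_le_mul_of_nonneg_left (g1 ω) (sub_nonneg.2 (hle ω)))
        _ = W * ((∑ ω, G (insert ω S)) / Fintype.card Ω) := by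
            rw [Finset.sum_div, Finset.mul_sum]
            exact Finset.sum_congr rfl fun ω _ => by ring

end transfer

/-! ### Chains -/

/-- strict chains of cells -/
def IsCh (C : Finset (ℕ × ℕ)) : Prop := ∀ a ∈ C, ∀ b ∈ C, a ≠ b →
  (a.1 < b.1 ∧ a.2 < b.2) ∨ (b.1 < a.1 ∧ b.2 < a.2)

theorem lis0_zero_left (ξ : ℕ → ℕ → Bool) (j : ℕ) : lis0 ξ 0 j = 0 := by
  cases j with
  | zero => rw [lis0, lpp_zero_right]
  | succ j => rw [lis0, lpp_zero_left]

theorem chain_le (X : Finset (ℕ × ℕ)) (i j : ℕ) : ∀ C ⊆ X, IsCh C → (∀ a ∈ C, a.1 < i ∧ a.2 < j) →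
    (C.card : ℤ) ≤ lis0 (fieldOf X) i j := by
  induction i generalizing j with
  | zero =>
    intro C _ _ h
    have : C = ∅ := Finset.eq_empty_of_forall_notMem fun a ha => absurd (h a ha).1 (by omega)
    rw [lis0_zero_left, this]; simp
  | succ i ihi =>
    induction j with
    | zero =>
      intro C _ _ h
      have : C = ∅ := Finset.eq_empty_of_forall_notMem fun a ha => absurd (h a ha).2 (by omega)
      rw [lis0, this, lpp_zero_right]; simp
    | succ j ihj =>
      intro C hC hch h
      rw [lis0, lpp_succ]
      by_cases hm : (i, j) ∈ C
      · have h1 : ((C.erase (i, j)).card : ℤ) ≤ lis0 (fieldOf X) i j := by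
          apply ihi j _ ((Finset.erase_subset _ _).trans hC)
          · intro a ha b hb
            exact hch a (Finset.mem_of_mem_erase ha) b (Finset.mem_of_mem_erase hb)
          · intro a ha
            have ha' := Finset.mem_of_mem_erase ha
            have := h a ha'
            rcases hch a ha' _ hm (Finset.ne_of_mem_erase ha) with h2 | h2
            · exact h2
            · simp only at h2; omega
        have h2 := Finset.card_erase_add_one hm
        have h3 : bz (fieldOf X j i) = 1 := by simp [bz, fieldOf, hC hm]
        rw [lis0] at h1
        omega
      · by_cases hr : ∃ a ∈ C, a.1 = i
        · obtain ⟨a, ha, hai⟩ := hr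
          have h1 : (C.card : ℤ) ≤ lis0 (fieldOf X) (i + 1) j := by
            apply ihj C hC hch
            intro b hb
            refine ⟨(h b hb).1, ?_⟩
            by_contra hc
            have hbj : b.2 = j := by have := (h b hb).2; omega
            have haj : a.2 < j := by
              have h2 := (h a ha).2
              rcases Nat.lt_succ_iff_lt_or_eq.1 h2 with h3 | h3
              · exact h3
              · exact absurd (show (i, j) ∈ C by rw [← hai, ← h3]; exact ha) hm
            have hne : a ≠ b := by rintro rfl; omega
            have := (h b hb).1
            rcases hch a ha b hb hne with h4 | h4
            · omega
            · omega
          rw [lis0] at h1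
          omega
        · have h1 : (C.card : ℤ) ≤ lis0 (fieldOf X) i (j + 1) := by
            apply ihi (j + 1) C hC hch
            intro b hb
            refine ⟨?_, (h b hb).2⟩
            have := (h b hb).1
            have : b.1 ≠ i := fun hh => hr ⟨b, hb, hh⟩
            omega
          rw [lis0] at h1
          omega

theorem exists_chain (X : Finset (ℕ × ℕ)) (i j : ℕ) : ∃ C ⊆ X, IsCh C ∧
    (∀ a ∈ C, a.1 < i ∧ a.2 < j) ∧ (C.card : ℤ) = lis0 (fieldOf X) i j := by
  induction i generalizing j with
  | zero =>
    refine ⟨∅, by simp, by intro a ha; simp at ha, by simp, ?_⟩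
    rw [lis0_zero_left]; simp
  | succ i ihi =>
    induction j with
    | zero =>
      refine ⟨∅, by simp, by intro a ha; simp at ha, by simp, ?_⟩
      rw [lis0, lpp_zero_right]; simp
    | succ j ihj =>
      obtain ⟨C1, a1, b1, c1, d1⟩ := ihi (j + 1)
      obtain ⟨C2, a2, b2, c2, d2⟩ := ihj
      obtain ⟨C3, a3, b3, c3, d3⟩ := ihi j
      rw [lis0] at d1 d2 d3
      rw [lis0, lpp_succ]
      rw [← d1, ← d2, ← d3]
      have key : ∃ C ⊆ X, IsCh C ∧ (∀ a ∈ C, a.1 < i + 1 ∧ a.2 < j + 1) ∧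
          (C.card : ℤ) = C3.card + bz (fieldOf X j i) := by
        by_cases hm : (i, j) ∈ X
        · have hn : (i, j) ∉ C3 := fun h => absurd (c3 _ h).1 (lt_irrefl _)
          refine ⟨insert (i, j) C3, Finset.insert_subset hm a3, ?_, ?_, ?_⟩
          · intro a ha b hb hab
            rcases Finset.mem_insert.1 ha with rfl | ha
            · rcases Finset.mem_insert.1 hb with rfl | hb
              · exact absurd rfl hab
              · exact Or.inr (c3 b hb)
            · rcases Finset.mem_insert.1 hb with rfl | hb
              · exact Or.inl (c3 a ha)
              · exact b3 a ha b hb hab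
          · intro a ha
            rcases Finset.mem_insert.1 ha with rfl | ha
            · simp
            · have := c3 a ha; omega
          · rw [Finset.card_insert_of_notMem hn]; simp [bz, fieldOf, hm]
        · refine ⟨C3, a3, b3, ?_, ?_⟩
          · intro a ha; have := c3 a ha; omega
          · simp [bz, fieldOf, hm]
      obtain ⟨C4, a4, b4, c4, d4⟩ := key
      rw [← d4]
      have e1 : ∀ a ∈ C1, a.1 < i + 1 ∧ a.2 < j + 1 := fun a ha => by have := c1 a ha; omega
      have e2 : ∀ a ∈ C2, a.1 < i + 1 ∧ a.2 < j + 1 := fun a ha => by have := c2 a ha; omega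
      rcases max_choice (max (C1.card : ℤ) C2.card) C4.card with h | h
      · rcases max_choice (C1.card : ℤ) C2.card with h' | h'
        · exact ⟨C1, a1, b1, e1, by rw [h, h']⟩
        · exact ⟨C2, a2, b2, e2, by rw [h, h']⟩
      · exact ⟨C4, a4, b4, c4, h.symm⟩

theorem lis0_perm {n M : ℕ} (x y : Fin n → ℕ) (hx : StrictMono x) (hy : StrictMono y)
    (hxM : ∀ i, x i < M) (hyM : ∀ i, y i < M) (π : Equiv.Perm (Fin n)) :
    lis0 (fieldOf (Finset.univ.image fun i => (x i, y (π i)))) M M = lisLength π := by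
  set p : Fin n → ℕ × ℕ := fun i => (x i, y (π i)) with hp
  have hinj : Function.Injective p := fun i j h => hx.injective (Prod.ext_iff.1 h).1
  apply le_antisymm
  · obtain ⟨C, hC, hch, -, hcard⟩ := exists_chain (Finset.univ.image p) M M
    rw [← hcard]
    set s := Finset.univ.filter (fun i => p i ∈ C) with hs
    have hCs : C = s.image p := by
      ext a
      rw [Finset.mem_image]
      constructor
      · intro ha
        obtain ⟨i, _, rfl⟩ := Finset.mem_image.1 (hC ha)
        exact ⟨i, by simp [hs, ha], rfl⟩
      · rintro ⟨i, hi, rfl⟩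
        exact (Finset.mem_filter.1 hi).2
    have hinc : ∀ i ∈ s, ∀ j ∈ s, i < j → π i < π j := by
      intro i hi j hj hij
      have h1 := (Finset.mem_filter.1 hi).2
      have h2 := (Finset.mem_filter.1 hj).2
      have hxx := hx hij
      rcases hch _ h1 _ h2 (fun h => hij.ne (hinj h)) with h | h
      · exact hy.lt_iff_lt.1 h.2
      · exact absurd h.1 (not_lt.2 hxx.le)
    rw [hCs, Finset.card_image_of_injective _ hinj]
    have := Finset.le_sup (f := fun s : Finset (Fin n) =>
      if ∀ i ∈ s, ∀ j ∈ s, i < j → π i < π j then s.card else 0)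
      (Finset.mem_powerset.2 (Finset.subset_univ s))
    simp only [if_pos hinc] at this
    exact_mod_cast this
  · have hnn : 0 ≤ lis0 (fieldOf (Finset.univ.image p)) M M := by
      have := chain_le (Finset.univ.image p) M M ∅ (by simp) (by intro a ha; simp at ha) (by simp)
      simpa using this
    have : lisLength π ≤ (lis0 (fieldOf (Finset.univ.image p)) M M).toNat := by
      apply Finset.sup_le
      intro s _
      split_ifs with h
      · have := chain_le (Finset.univ.image p) M M (s.image p)
          (Finset.image_subset_image (Finset.subset_univ s)) ?_ ?_
        · rw [Finset.card_image_of_injective _ hinj] at this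
          omega
        · intro a ha b hb hab
          obtain ⟨i, hi, rfl⟩ := Finset.mem_image.1 ha
          obtain ⟨j, hj, rfl⟩ := Finset.mem_image.1 hb
          rcases lt_trichotomy i j with hij | hij | hij
          · exact Or.inl ⟨hx hij, hy (h i hi j hj hij)⟩
          · exact absurd (congrArg p hij) hab
          · exact Or.inr ⟨hx hij, hy (h j hj i hi hij)⟩
        · intro a ha
          obtain ⟨i, hi, rfl⟩ := Finset.mem_image.1 ha
          exact ⟨hxM _, hyM _⟩
      · exact Nat.zero_le _
    omega

/-! ### Samples of points -/

/-- longest chain of a sample -/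
def lisZ {n M : ℕ} (z : Fin n → Fin M × Fin M) : ℤ :=
  lis0 (fieldOf ((Finset.univ.image z).map (cellEmb M))) M M

/-- inversions of a sample -/
def invZ {n M : ℕ} (z : Fin n → Fin M × Fin M) : ℕ :=
  (Finset.univ.filter (fun p : Fin n × Fin n => (z p.1).1 < (z p.2).1 ∧ (z p.2).2 < (z p.1).2)).card

theorem lisZ_comp {n M : ℕ} (z : Fin n → Fin M × Fin M) (σ : Equiv.Perm (Fin n)) :
    lisZ (fun i => z (σ i)) = lisZ z := by
  unfold lisZ
  congr 3
  ext a
  simp only [Finset.mem_image, Finset.mem_univ, true_and]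
  exact ⟨fun ⟨i, h⟩ => ⟨σ i, h⟩, fun ⟨i, h⟩ => ⟨σ.symm i, by simpa using h⟩⟩

theorem invZ_comp {n M : ℕ} (z : Fin n → Fin M × Fin M) (σ : Equiv.Perm (Fin n)) :
    invZ (fun i => z (σ i)) = invZ z := by
  unfold invZ
  refine Finset.card_bij (fun p _ => (σ p.1, σ p.2)) ?_ ?_ ?_
  · intro p hp; simpa using hp
  · intro p _ p' _ h
    simpa [Prod.ext_iff] using h
  · intro p hp
    exact ⟨(σ.symm p.1, σ.symm p.2), by simpa using hp, by simp⟩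

theorem lisZ_perm {n M : ℕ} (x y : Fin n → Fin M) (hx : StrictMono x) (hy : StrictMono y)
    (π : Equiv.Perm (Fin n)) : lisZ (fun i => (x i, y (π i))) = lisLength π := by
  rw [← lis0_perm (M := M) (fun i => (x i : ℕ)) (fun i => (y i : ℕ)) hx hy (fun i => (x i).2)
    (fun i => (y i).2) π]
  unfold lisZ
  congr 2
  rw [Finset.map_eq_image, Finset.image_image]
  rfl

theorem invZ_perm {n M : ℕ} (x y : Fin n → Fin M) (hx : StrictMono x) (hy : StrictMono y)
    (π : Equiv.Perm (Fin n)) : invZ (fun i => (x i, y (π i))) = inversions π := by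
  unfold invZ inversions
  simp only [hx.lt_iff_lt, hy.lt_iff_lt]

theorem emb_sort {n M : ℕ} (x : Fin n ↪ Fin M) :
    ∃ (x0 : Fin n → Fin M) (σ : Equiv.Perm (Fin n)), StrictMono x0 ∧ ∀ i, x i = x0 (σ i) := by
  refine ⟨x ∘ Tuple.sort x, (Tuple.sort x).symm, ?_, fun i => by simp⟩
  exact (Tuple.monotone_sort x).strictMono_of_injective
    (x.injective.comp (Tuple.sort x).injective)

/-- Sum of a permutation-invariant function over pairs of injections. -/
theorem sum_emb {n M : ℕ} (Φ : (Fin n → Fin M × Fin M) → ℝ)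
    (hΦ : ∀ z (σ : Equiv.Perm (Fin n)), Φ (fun i => z (σ i)) = Φ z)
    (φ : Equiv.Perm (Fin n) → ℝ)
    (hφ : ∀ x y : Fin n → Fin M, StrictMono x → StrictMono y → ∀ π : Equiv.Perm (Fin n),
      Φ (fun i => (x i, y (π i))) = φ π) :
    (Fintype.card (Equiv.Perm (Fin n)) : ℝ) * ∑ x : Fin n ↪ Fin M, ∑ y : Fin n ↪ Fin M,
      Φ (fun i => (x i, y i)) = (Fintype.card (Fin n ↪ Fin M) : ℝ) ^ 2 * ∑ π, φ π := by
  have key : ∀ x : Fin n ↪ Fin M, (Fintype.card (Equiv.Perm (Fin n)) : ℝ) * ∑ y : Fin n ↪ Fin M,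
      Φ (fun i => (x i, y i)) = (Fintype.card (Fin n ↪ Fin M) : ℝ) * ∑ π, φ π := by
    intro x
    obtain ⟨x0, σ, hx0, hx⟩ := emb_sort x
    have h1 : ∀ y : Fin n ↪ Fin M, ∑ ρ : Equiv.Perm (Fin n), Φ (fun i => (x i, y (ρ i))) =
        ∑ π, φ π := by
      intro y
      obtain ⟨y0, τ, hy0, hy⟩ := emb_sort y
      have e : ∀ ρ : Equiv.Perm (Fin n), Φ (fun i => (x i, y (ρ i))) =
          φ (τ * ρ * σ⁻¹) := by
        intro ρ
        rw [← hφ x0 y0 hx0 hy0 (τ * ρ * σ⁻¹)]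
        rw [← hΦ (fun i => (x0 i, y0 ((τ * ρ * σ⁻¹) i))) σ]
        congr 1; funext i
        simp [hx, hy]
      simp only [e]
      exact Fintype.sum_equiv ((Equiv.mulLeft τ).trans (Equiv.mulRight σ⁻¹)) _ _ (fun ρ => rfl)
    have h2 : ∀ ρ : Equiv.Perm (Fin n), ∑ y : Fin n ↪ Fin M, Φ (fun i => (x i, y (ρ i))) =
        ∑ y : Fin n ↪ Fin M, Φ (fun i => (x i, y i)) := by
      intro ρ
      exact Fintype.sum_equiv (Equiv.embeddingCongr ρ.symm (Equiv.refl _)) _ _ (fun y => by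
        simp [Equiv.embeddingCongr])
    calc _ = ∑ ρ : Equiv.Perm (Fin n), ∑ y : Fin n ↪ Fin M, Φ (fun i => (x i, y (ρ i))) := by
          simp only [h2, Finset.sum_const, Finset.card_univ, nsmul_eq_mul]
      _ = _ := by
          rw [Finset.sum_comm]
          simp only [h1, Finset.sum_const, Finset.card_univ, nsmul_eq_mul]
  rw [Finset.mul_sum]
  simp only [key, Finset.sum_const, Finset.card_univ, nsmul_eq_mul]
  ring

open Filter
/-! ### Comparing Mallows with weighted samples -/

theorem invZ_le_of_agree {n M : ℕ} (z z' : Fin n → Fin M × Fin M) (i : Fin n)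
    (h : ∀ a, a ≠ i → z a = z' a) : invZ z ≤ invZ z' + n := by
  classical
  set S := Finset.univ.filter (fun p : Fin n × Fin n =>
    (z p.1).1 < (z p.2).1 ∧ (z p.2).2 < (z p.1).2) with hS
  set S' := Finset.univ.filter (fun p : Fin n × Fin n =>
    (z' p.1).1 < (z' p.2).1 ∧ (z' p.2).2 < (z' p.1).2) with hS'
  have hsub : S ⊆ S' ∪ S.filter (fun p => p.1 = i ∨ p.2 = i) := by
    intro p hp
    by_cases hi : p.1 = i ∨ p.2 = i
    · exact Finset.mem_union_right _ (Finset.mem_filter.2 ⟨hp, hi⟩)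
    · push Not at hi
      apply Finset.mem_union_left
      rw [hS'] ; rw [hS] at hp
      simp only [Finset.mem_filter, Finset.mem_univ, true_and] at hp ⊢
      rw [← h _ hi.1, ← h _ hi.2]; exact hp
  have hcard : (S.filter (fun p => p.1 = i ∨ p.2 = i)).card ≤ n := by
    calc _ ≤ (Finset.univ : Finset (Fin n)).card := by
          apply Finset.card_le_card_of_injOn (fun p => if p.1 = i then p.2 else p.1)
          · intro a _; simp
          · intro p hp p' hp' hpp
            rw [hS] at hp hp'
            simp only [Finset.coe_filter, Finset.mem_filter, Finset.mem_univ, true_and,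
              Set.mem_ofPred_eq] at hp hp'
            obtain ⟨⟨a1, a2⟩, a3⟩ := hp
            obtain ⟨⟨b1, b2⟩, b3⟩ := hp'
            obtain ⟨x, y⟩ := p
            obtain ⟨x', y'⟩ := p'
            simp only at a1 a2 a3 b1 b2 b3 hpp ⊢
            by_cases hx : x = i
            · by_cases hx' : x' = i
              · simp only [hx, hx', if_true] at hpp
                rw [hx, hx', hpp]
              · have hy' : y' = i := b3.resolve_left hx'
                simp only [hx, hx', if_true, if_false] at hpp
                subst hpp; subst hx; subst hy'
                exact absurd a1 (lt_asymm b1)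
            · have hy : y = i := a3.resolve_left hx
              by_cases hx' : x' = i
              · simp only [hx, hx', if_true, if_false] at hpp
                subst hpp; subst hy; subst hx'
                exact absurd a1 (lt_asymm b1)
              · have hy' : y' = i := b3.resolve_left hx'
                simp only [hx, hx', if_false] at hpp
                rw [hpp, hy, hy']
      _ = n := by simp
  calc invZ z = S.card := rfl
    _ ≤ _ := Finset.card_le_card hsub
    _ ≤ _ := Finset.card_union_le _ _
    _ ≤ S'.card + n := by omega

theorem ratio_inv (n M : ℕ) (q : ℝ) (hq : 0 < q) :
    Ratio ((min q q⁻¹) ^ n) (fun z : Fin n → Fin M × Fin M => q ^ invZ z) := by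
  intro z i y
  have h1 := invZ_le_of_agree z (Function.update z i y) i (fun a ha => by simp [ha])
  have h2 := invZ_le_of_agree (Function.update z i y) z i (fun a ha => by simp [ha])
  set a := invZ z
  set b := invZ (Function.update z i y)
  change (min q q⁻¹) ^ n * q ^ a ≤ q ^ b
  rcases le_total q 1 with hq1 | hq1
  · calc _ ≤ q ^ n * q ^ a := by gcongr; exact min_le_left _ _
      _ = q ^ (a + n) := by rw [pow_add]; ring
      _ ≤ q ^ b := pow_le_pow_of_le_one hq.le hq1 h2
  · calc _ ≤ q⁻¹ ^ n * q ^ a := by gcongr; exact min_le_right _ _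
      _ ≤ q⁻¹ ^ n * q ^ (b + n) := by gcongr
      _ = q ^ b := by rw [pow_add, inv_pow]; field_simp

theorem invZ_le (n M : ℕ) (z : Fin n → Fin M × Fin M) : invZ z ≤ n * n := by
  calc _ ≤ (Finset.univ : Finset (Fin n × Fin n)).card := Finset.card_filter_le _ _
    _ = n * n := by simp

theorem w_bounds (n M : ℕ) (q : ℝ) (hq : 0 < q) (z : Fin n → Fin M × Fin M) :
    (min q 1) ^ (n * n) ≤ q ^ invZ z ∧ q ^ invZ z ≤ (max q 1) ^ (n * n) := by
  have hm : 0 < min q 1 := lt_min hq one_pos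
  constructor
  · calc _ ≤ (min q 1) ^ invZ z := pow_le_pow_of_le_one hm.le (min_le_right _ _) (invZ_le n M z)
      _ ≤ _ := by gcongr; exact min_le_left _ _
  · calc _ ≤ (max q 1) ^ invZ z := by gcongr; exact le_max_left _ _
      _ ≤ _ := pow_le_pow_right₀ (le_max_right _ _) (invZ_le n M z)

/-- pairing two injections -/
def pairEmb (n M : ℕ) : (Fin n ↪ Fin M) × (Fin n ↪ Fin M) ↪ (Fin n → Fin M × Fin M) where
  toFun p := fun i => (p.1 i, p.2 i)
  inj' := by
    intro p p' h
    apply Prod.ext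
    · ext i
      have := congrFun h i
      simp only [Prod.ext_iff] at this
      rw [this.1]
    · ext i
      have := congrFun h i
      simp only [Prod.ext_iff] at this
      rw [this.2]

theorem emb_le (n M : ℕ) (Φ : (Fin n → Fin M × Fin M) → ℝ) (h : ∀ z, 0 ≤ Φ z) :
    ∑ x : Fin n ↪ Fin M, ∑ y : Fin n ↪ Fin M, Φ (fun i => (x i, y i)) ≤ ∑ z, Φ z := by
  rw [← Fintype.sum_prod_type' (f := fun x y : Fin n ↪ Fin M => Φ (fun i => (x i, y i)))]
  have := Finset.sum_map Finset.univ (pairEmb n M) Φ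
  calc _ = _ := this.symm
    _ ≤ _ := Finset.sum_le_univ_sum_of_nonneg h

theorem emb_card (n : ℕ) (κ : ℝ) (hκ : 0 < κ) : ∀ᶠ M : ℕ in atTop,
    0 < (Fintype.card (Fin n ↪ Fin M) : ℝ) ∧
    ((M : ℝ) ^ n) ^ 2 ≤ (1 + κ) * (Fintype.card (Fin n ↪ Fin M) : ℝ) ^ 2 := by
  have h1 := isEquivalent_descFactorial n
  have hz : ∀ᶠ M : ℕ in atTop, ((M : ℝ) ^ n) ≠ 0 := by
    filter_upwards [eventually_gt_atTop 0] with M hM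
    positivity
  have h2 := (Asymptotics.isEquivalent_iff_tendsto_one hz).1 h1
  have h3 := h2.pow 2
  have h4 : (1 : ℝ) / (1 + κ) < 1 ^ 2 := by
    rw [one_pow, div_lt_one (by positivity)]; linarith
  filter_upwards [h3.eventually (eventually_gt_nhds h4), eventually_gt_atTop 0,
    eventually_ge_atTop n] with M h5 hM hMn
  have hcard : Fintype.card (Fin n ↪ Fin M) = M.descFactorial n := by
    rw [Fintype.card_embedding_eq]; simp
  rw [hcard]
  constructor
  · exact_mod_cast Nat.descFactorial_pos.2 hMn
  · have hM' : (0 : ℝ) < M := by exact_mod_cast hM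
    simp only [Pi.div_apply, Pi.pow_apply, div_pow] at h5
    rw [div_lt_div_iff₀ (by positivity) (by positivity)] at h5
    linarith

theorem emb_half (n : ℕ) (q : ℝ) (hq : 0 < q) : ∀ᶠ M : ℕ in atTop,
    0 < (Fintype.card (Fin n ↪ Fin M) : ℝ) ∧
    ∑ z : Fin n → Fin M × Fin M, q ^ invZ z ≤
      2 * ∑ x : Fin n ↪ Fin M, ∑ y : Fin n ↪ Fin M, q ^ invZ (fun i => (x i, y i)) := by
  have ha : 0 < (min q 1) ^ (n * n) := pow_pos (lt_min hq one_pos) _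
  have hb : 0 < (max q 1) ^ (n * n) := pow_pos (lt_max_of_lt_left hq) _
  filter_upwards [emb_card n _ (div_pos ha hb)] with M hM
  refine ⟨hM.1, ?_⟩
  have hM2 := hM.2
  set a := (min q 1) ^ (n * n)
  set b := (max q 1) ^ (n * n)
  set I := (Fintype.card (Fin n ↪ Fin M) : ℝ)
  rw [← Fintype.sum_prod_type' (f := fun x y : Fin n ↪ Fin M => q ^ invZ (fun i => (x i, y i)))]
  have e1 := Finset.sum_map Finset.univ (pairEmb n M) (fun z => q ^ invZ z)
  set T := Finset.univ.map (pairEmb n M) with hT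
  have e2 := Finset.sum_add_sum_compl T (fun z => q ^ invZ z)
  have hTc : (T.card : ℝ) = I ^ 2 := by
    rw [hT, Finset.card_map, Finset.card_univ, Fintype.card_prod]; push_cast; ring
  have hTcc : (Tᶜ.card : ℝ) = ((M : ℝ) ^ n) ^ 2 - I ^ 2 := by
    have := Finset.card_add_card_compl T
    have h' : (T.card : ℝ) + Tᶜ.card = ((M : ℝ) ^ n) ^ 2 := by
      have h3 : (T.card : ℝ) + Tᶜ.card = ((Fintype.card (Fin n → Fin M × Fin M) : ℕ) : ℝ) := by
        exact_mod_cast this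
      rw [h3]; simp; ring
    linarith
  have l1 : I ^ 2 * a ≤ ∑ z ∈ T, q ^ invZ z := by
    rw [← hTc, ← nsmul_eq_mul]
    exact Finset.card_nsmul_le_sum _ _ _ fun z _ => (w_bounds n M q hq z).1
  have l2 : ∑ z ∈ Tᶜ, q ^ invZ z ≤ (((M : ℝ) ^ n) ^ 2 - I ^ 2) * b := by
    rw [← hTcc, ← nsmul_eq_mul]
    exact Finset.sum_le_card_nsmul _ _ _ fun z _ => (w_bounds n M q hq z).2
  have l3 : (((M : ℝ) ^ n) ^ 2 - I ^ 2) * b ≤ I ^ 2 * a := by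
    have : ((M : ℝ) ^ n) ^ 2 - I ^ 2 ≤ a / b * I ^ 2 := by linarith
    calc _ ≤ a / b * I ^ 2 * b := by gcongr
      _ = _ := by field_simp
  have e3 : ∑ x : (Fin n ↪ Fin M) × (Fin n ↪ Fin M), q ^ invZ (fun i => (x.1 i, x.2 i)) =
    ∑ z ∈ T, q ^ invZ z := e1.symm
  rw [e3]
  linarith

open Classical in
theorem mallows_le (n : ℕ) (q : ℝ) (hq : 0 < q) : ∀ᶠ M : ℕ in atTop, ∀ A : ℤ → Prop,
    mallowsProb n q {π | A (lisLength π)} * ∑ z : Fin n → Fin M × Fin M, q ^ invZ z ≤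
      2 * ∑ z : Fin n → Fin M × Fin M, q ^ invZ z * (if A (lisZ z) then 1 else 0) := by
  filter_upwards [emb_half n q hq] with M hM A
  obtain ⟨hI, hh⟩ := hM
  have s1 := sum_emb (n := n) (M := M) (fun z => q ^ invZ z) (fun z σ => by simp only [invZ_comp])
    (fun π => q ^ inversions π) (fun x y hx hy π => by simp only [invZ_perm x y hx hy])
  have s2 := sum_emb (n := n) (M := M) (fun z => q ^ invZ z * (if A (lisZ z) then 1 else 0))
    (fun z σ => by simp only [invZ_comp, lisZ_comp])
    (fun π => q ^ inversions π * (if A (lisLength π) then 1 else 0))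
    (fun x y hx hy π => by simp only [invZ_perm x y hx hy, lisZ_perm x y hx hy])
  have s3 := emb_le n M (fun z => q ^ invZ z * (if A (lisZ z) then 1 else 0))
    (fun z => by positivity)
  have hP : 0 < ∑ π : Equiv.Perm (Fin n), q ^ inversions π :=
    Finset.sum_pos (fun π _ => by positivity) Finset.univ_nonempty
  have hPA : mallowsProb n q {π | A (lisLength π)} = (∑ π : Equiv.Perm (Fin n),
      q ^ inversions π * (if A (lisLength π) then 1 else 0)) /
      ∑ π : Equiv.Perm (Fin n), q ^ inversions π := by
    unfold mallowsProb
    congr 1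
    apply Finset.sum_congr rfl
    intro π _
    simp [Set.indicator_apply]
  have hPA0 : 0 ≤ ∑ π : Equiv.Perm (Fin n),
      q ^ inversions π * (if A (lisLength π) then (1 : ℝ) else 0) :=
    Finset.sum_nonneg fun π _ => by positivity
  rw [hPA, div_mul_eq_mul_div, div_le_iff₀ hP]
  set G := (Fintype.card (Equiv.Perm (Fin n)) : ℝ)
  set I := (Fintype.card (Fin n ↪ Fin M) : ℝ)
  set P := ∑ π : Equiv.Perm (Fin n), q ^ inversions π
  set PA := ∑ π : Equiv.Perm (Fin n), q ^ inversions π * (if A (lisLength π) then (1 : ℝ) else 0)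
  set E := ∑ x : Fin n ↪ Fin M, ∑ y : Fin n ↪ Fin M, q ^ invZ (fun i => (x i, y i))
  set EA := ∑ x : Fin n ↪ Fin M, ∑ y : Fin n ↪ Fin M, q ^ invZ (fun i => (x i, y i)) *
    (if A (lisZ (fun i => (x i, y i))) then (1 : ℝ) else 0)
  have hc : PA * E = EA * P := by
    have : I ^ 2 * (PA * E) = I ^ 2 * (EA * P) := by
      calc I ^ 2 * (PA * E) = (I ^ 2 * PA) * E := by ring
        _ = EA * (G * E) := by rw [← s2]; ring
        _ = _ := by rw [s1]; ring
    exact mul_left_cancel₀ (by positivity) this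
  calc _ ≤ PA * (2 * E) := by gcongr
    _ = 2 * EA * P := by linarith
    _ ≤ _ := by gcongr

open Filter Topology Ex
/-! ### Final assembly -/

theorem lis0_fieldOf_mono (X Y : Finset (ℕ × ℕ)) (h : X ⊆ Y) (i j : ℕ) :
    lis0 (fieldOf X) i j ≤ lis0 (fieldOf Y) i j := by
  apply lpp_mono
  · intro i j
    by_cases hx : (i, j) ∈ X
    · simp [bz, fieldOf, hx, h hx]
    · by_cases hy : (i, j) ∈ Y <;> simp [bz, fieldOf, hx, hy]
  · intro i; exact le_rfl
  · intro i; exact le_rfl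

open Classical in
theorem indic_mono (M : ℕ) (A : ℤ → Prop) (hA : ∀ a b, a ≤ b → A a → A b) :
    FMono (fun X : Finset (Fin M × Fin M) =>
      if A (lis0 (fieldOf (X.map (cellEmb M))) M M) then (1 : ℝ) else 0) := by
  intro S ω
  simp only
  have h := lis0_fieldOf_mono (S.map (cellEmb M)) ((insert ω S).map (cellEmb M))
    (Finset.map_subset_map.2 (Finset.subset_insert _ _)) M M
  split_ifs with h1 h2
  · exact le_rfl
  · exact absurd (hA _ _ h h1) h2
  · exact zero_le_one
  · exact le_rfl

theorem rate_card (l : ℝ) (M : ℕ) (hM : 0 < M) :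
    l / (M : ℝ) ^ 2 * Fintype.card (Fin M × Fin M) = l := by
  have : (0 : ℝ) < M := by exact_mod_cast hM
  simp only [Fintype.card_prod, Fintype.card_fin]
  push_cast
  field_simp

theorem minq (q : ℝ) (hq : 0 < q) (n : ℕ) :
    0 ≤ (min q q⁻¹) ^ n ∧ (min q q⁻¹) ^ n ≤ 1 := by
  have h0 : 0 < min q q⁻¹ := lt_min hq (inv_pos.2 hq)
  refine ⟨by positivity, pow_le_one₀ h0.le ?_⟩
  rcases le_total q 1 with h | h
  · exact (min_le_left _ _).trans h
  · exact (min_le_right _ _).trans (inv_le_one_of_one_le₀ h)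

theorem core_up (n M N : ℕ) (q l θ : ℝ) (hq : 0 < q) (hM : 0 < M) (A : ℤ → Prop)
    (hA : ∀ a b, a ≤ b → A a → A b) (h0 : 0 ≤ pm l M) (h1 : pm l M ≤ 1) (hl : 0 ≤ l)
    (hθ : 0 < θ) (hθ1 : θ ≤ 1)
    (hmal : mallowsProb n q {π | A (lisLength π)} * ∑ z : Fin n → Fin M × Fin M, q ^ invZ z ≤
      2 * ∑ z : Fin n → Fin M × Fin M, q ^ invZ z * (open Classical in if A (lisZ z) then 1 else 0))
    (hR : 1 - binR ((min q q⁻¹) ^ n) N n ≤ 1 / 2)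
    (hC : (θ ^ N)⁻¹ * Real.exp (l * (θ - 1)) ≤ 1 / 2) :
    mallowsProb n q {π | A (lisLength π)} ≤
      8 * (fld (pm l M) h0 h1 M).pr (fun ξ => A (lis0 ξ M M)) := by
  classical
  have : Nonempty (Fin M × Fin M) := ⟨(⟨0, hM⟩, ⟨0, hM⟩)⟩
  set F : Finset (Fin M × Fin M) → ℝ := fun X =>
    if A (lis0 (fieldOf (X.map (cellEmb M))) M M) then (1 : ℝ) else 0 with hF
  have hFm : FMono F := by
    have := indic_mono M A hA
    convert this
  have hF01 : ∀ S, 0 ≤ F S ∧ F S ≤ 1 := by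
    intro S; simp only [hF]; split_ifs <;> norm_num
  set b := (fld (pm l M) h0 h1 M).pr (fun ξ => A (lis0 ξ M M)) with hb
  have hb' : b = Real.exp (-(l / (M : ℝ) ^ 2 * Fintype.card (Fin M × Fin M))) *
      ∑ X : Finset (Fin M × Fin M), (Real.exp (l / (M : ℝ) ^ 2) - 1) ^ X.card * F X := by
    rw [hb, Ex.pr, fld_pois]
  have hp := pois_up (l / (M : ℝ) ^ 2) (by positivity) F hFm hF01 N θ hθ hθ1 b hb'
  rw [rate_card l M hM] at hp
  set w : (Fin n → Fin M × Fin M) → ℝ := fun z => q ^ invZ z with hw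
  have hw0 : ∀ z, 0 < w z := fun z => by simp only [hw]; positivity
  obtain ⟨c0, c1⟩ := minq q hq n
  have ht := transfer_upper c0 c1 hFm (fun S => (hF01 S).1) N n w hw0 (ratio_inv n M q hq) ∅
  have hws : ∑ z : Fin n → Fin M × Fin M, q ^ invZ z * (if A (lisZ z) then (1 : ℝ) else 0) =
      wsum w F ∅ := by
    unfold wsum
    apply Finset.sum_congr rfl
    intro z _
    simp only [hw, hF, lisZ, Finset.empty_union]
    congr 1
  have hmal' : mallowsProb n q {π | A (lisLength π)} * wtot w ≤ 2 * wsum w F ∅ := by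
    rw [← hws]; convert hmal using 2; rfl
  have hW : 0 < wtot w := Finset.sum_pos (fun z _ => hw0 z) Finset.univ_nonempty
  have hws0 : 0 ≤ wsum w F ∅ :=
    Finset.sum_nonneg fun z _ => mul_nonneg (hw0 z).le (hF01 _).1
  have ha := (av_mem hF01 N ∅).1
  have k1 : av^[N] F ∅ ≤ 2 * b := by nlinarith
  have k2 : wsum w F ∅ ≤ 2 * (wtot w * av^[N] F ∅) := by nlinarith
  have k3 : wtot w * av^[N] F ∅ ≤ wtot w * (2 * b) := by gcongr
  have : mallowsProb n q {π | A (lisLength π)} * wtot w ≤ (8 * b) * wtot w := by nlinarith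
  exact le_of_mul_le_mul_right this hW

theorem core_low (n M k : ℕ) (q l θ : ℝ) (hq : 0 < q) (hM : 0 < M) (A : ℤ → Prop)
    (hA : ∀ a b, a ≤ b → A b → A a) (h0 : 0 ≤ pm l M) (h1 : pm l M ≤ 1) (hl : 0 ≤ l)
    (hθ1 : 1 ≤ θ)
    (hmal : mallowsProb n q {π | A (lisLength π)} * ∑ z : Fin n → Fin M × Fin M, q ^ invZ z ≤
      2 * ∑ z : Fin n → Fin M × Fin M, q ^ invZ z * (open Classical in if A (lisZ z) then 1 else 0))
    (hC : (θ ^ k)⁻¹ * Real.exp (l * (θ - 1)) ≤ 1 / 2) :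
    mallowsProb n q {π | A (lisLength π)} ≤ 2 * (1 - binR ((min q q⁻¹) ^ n) n k) +
      4 * (fld (pm l M) h0 h1 M).pr (fun ξ => A (lis0 ξ M M)) := by
  classical
  have : Nonempty (Fin M × Fin M) := ⟨(⟨0, hM⟩, ⟨0, hM⟩)⟩
  set F : Finset (Fin M × Fin M) → ℝ := fun X =>
    if ¬ A (lis0 (fieldOf (X.map (cellEmb M))) M M) then (1 : ℝ) else 0 with hF
  have hFm : FMono F := by
    have := indic_mono M (fun a => ¬ A a) (fun a b hab ha hb => ha (hA a b hab hb))
    convert this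
  have hF01 : ∀ S, 0 ≤ F S ∧ F S ≤ 1 := by
    intro S; simp only [hF]; split_ifs <;> norm_num
  set b := (fld (pm l M) h0 h1 M).pr (fun ξ => ¬ A (lis0 ξ M M)) with hb
  have hb' : b = Real.exp (-(l / (M : ℝ) ^ 2 * Fintype.card (Fin M × Fin M))) *
      ∑ X : Finset (Fin M × Fin M), (Real.exp (l / (M : ℝ) ^ 2) - 1) ^ X.card * F X := by
    rw [hb, Ex.pr, fld_pois]
    simp only [hF]
    congr! 5
  have hbn := pr_not (fld (pm l M) h0 h1 M) (fun ξ => A (lis0 ξ M M))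
  have hp := pois_low (l / (M : ℝ) ^ 2) (by positivity) F hFm hF01 k θ hθ1 b hb'
  rw [rate_card l M hM] at hp
  set w : (Fin n → Fin M × Fin M) → ℝ := fun z => q ^ invZ z with hw
  have hw0 : ∀ z, 0 < w z := fun z => by simp only [hw]; positivity
  obtain ⟨c0, c1⟩ := minq q hq n
  have ht := transfer_lower c0 c1 hFm w hw0 (ratio_inv n M q hq) ∅
  have hlav := lav_ge c0 c1 hFm (fun S => (hF01 S).1) n k ∅
  have hws : ∑ z : Fin n → Fin M × Fin M, q ^ invZ z * (if A (lisZ z) then (1 : ℝ) else 0) =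
      wtot w - wsum w F ∅ := by
    unfold wsum wtot
    rw [← Finset.sum_sub_distrib]
    apply Finset.sum_congr rfl
    intro z _
    simp only [hw, hF, lisZ, Finset.empty_union]
    split_ifs <;> simp_all
  have hmal' : mallowsProb n q {π | A (lisLength π)} * wtot w ≤ 2 * (wtot w - wsum w F ∅) := by
    rw [← hws]; convert hmal using 2; rfl
  have hW : 0 < wtot w := Finset.sum_pos (fun z _ => hw0 z) Finset.univ_nonempty
  have ha := av_mem hF01 k ∅
  have hR := binR_mem c0 c1 n k
  set R := binR ((min q q⁻¹) ^ n) n k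
  set a := av^[k] F ∅
  have k1 : 1 - a ≤ 2 * (1 - b) := by nlinarith
  have k2 : wtot w * (R * a) ≤ wsum w F ∅ := (mul_le_mul_of_nonneg_left hlav hW.le).trans ht
  have k3 : 1 - R * a ≤ (1 - R) + (1 - a) := by nlinarith
  have k4 : mallowsProb n q {π | A (lisLength π)} * wtot w ≤ (2 * (1 - R * a)) * wtot w := by
    nlinarith
  have k5 := le_of_mul_le_mul_right k4 hW
  have : 1 - b = (fld (pm l M) h0 h1 M).pr (fun ξ => A (lis0 ξ M M)) := by rw [hb, hbn]; ring
  rw [← this]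
  linarith

/-! ### Chernoff factors -/

/-- upper Chernoff base -/
noncomputable def chU (g : ℝ) : ℝ := g * Real.exp (-(g - 1))

/-- lower Chernoff base -/
noncomputable def chL (g : ℝ) : ℝ := g⁻¹ * Real.exp ((g - 1) / g)

theorem chU_mem {g : ℝ} (hg : 1 < g) : 0 ≤ chU g ∧ chU g < 1 := by
  refine ⟨by unfold chU; positivity, ?_⟩
  have := Real.add_one_lt_exp (x := g - 1) (by linarith)
  unfold chU
  rw [Real.exp_neg, ← div_eq_mul_inv, div_lt_one (Real.exp_pos _)]
  linarith

theorem chL_mem {g : ℝ} (hg : 1 < g) : 0 ≤ chL g ∧ chL g < 1 := by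
  have hg0 : 0 < g := by linarith
  refine ⟨by unfold chL; positivity, ?_⟩
  have := Real.add_one_lt_exp (x := -((g - 1) / g)) (by
    have : 0 < (g - 1) / g := div_pos (by linarith) hg0
    linarith)
  rw [Real.exp_neg] at this
  have e : -((g - 1) / g) + 1 = g⁻¹ := by field_simp; ring
  rw [e] at this
  unfold chL
  calc _ < (Real.exp ((g - 1) / g))⁻¹ * Real.exp ((g - 1) / g) := by gcongr
    _ = 1 := inv_mul_cancel₀ (Real.exp_pos _).ne'

theorem bin_ch {g c : ℝ} (hg : 1 < g) (h0 : 0 ≤ c) (h1 : c ≤ 1) (N k : ℕ) (h : g * k ≤ c * N) :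
    1 - binR c N k ≤ chU g ^ k := by
  have hg0 : 0 < g := by linarith
  have := binR_chernoff h0 h1 (inv_pos.2 hg0) (inv_le_one_of_one_le₀ hg.le) N k
  refine this.trans ?_
  have hX : 0 ≤ 1 - c + c * g⁻¹ := by have := sub_nonneg.2 h1; positivity
  have e1 : 1 - c + c * g⁻¹ ≤ Real.exp (-(c * (1 - g⁻¹))) := by
    have := Real.add_one_le_exp (-(c * (1 - g⁻¹)))
    linarith
  have hgi : 0 ≤ 1 - g⁻¹ := by have := inv_le_one_of_one_le₀ hg.le; linarith
  rw [chU, mul_pow, inv_pow, inv_inv]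
  gcongr
  calc _ ≤ Real.exp (-(c * (1 - g⁻¹))) ^ N := by gcongr
    _ = Real.exp (-((c * N) * (1 - g⁻¹))) := by rw [← Real.exp_nat_mul]; congr 1; ring
    _ ≤ Real.exp (-((g * k) * (1 - g⁻¹))) := by gcongr
    _ = _ := by rw [← Real.exp_nat_mul]; congr 1; field_simp

theorem ch_up {g : ℝ} (hg : 1 < g) (N : ℕ) :
    ((g⁻¹) ^ N)⁻¹ * Real.exp ((g * N) * (g⁻¹ - 1)) = chU g ^ N := by
  have hg0 : 0 < g := by linarith
  rw [chU, mul_pow, inv_pow, inv_inv, ← Real.exp_nat_mul]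
  congr 2; field_simp; ring

theorem ch_low {g : ℝ} (hg : 1 < g) (k : ℕ) :
    (g ^ k)⁻¹ * Real.exp ((k / g) * (g - 1)) = chL g ^ k := by
  have hg0 : 0 < g := by linarith
  rw [chL, mul_pow, inv_pow, ← Real.exp_nat_mul]
  congr 2; field_simp

/-! ### Elementary facts about `mallowsProb` -/

theorem Zpos (n : ℕ) (q : ℝ) (hq : 0 < q) : 0 < ∑ π : Equiv.Perm (Fin n), q ^ inversions π :=
  Finset.sum_pos (fun π _ => by positivity) Finset.univ_nonempty

theorem mp_mono (n : ℕ) (q : ℝ) (hq : 0 < q) {A B : Set (Equiv.Perm (Fin n))} (h : A ⊆ B) :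
    mallowsProb n q A ≤ mallowsProb n q B := by
  unfold mallowsProb
  have := Zpos n q hq
  gcongr with π _

theorem mp_univ (n : ℕ) (q : ℝ) (hq : 0 < q) : mallowsProb n q Set.univ = 1 := by
  unfold mallowsProb
  simp only [Set.indicator_univ]
  exact div_self (Zpos n q hq).ne'

theorem mp_cover (n : ℕ) (q : ℝ) (hq : 0 < q) (A B C : Set (Equiv.Perm (Fin n)))
    (h : ∀ π, π ∈ A ∨ π ∈ B ∨ π ∈ C) :
    1 ≤ mallowsProb n q A + mallowsProb n q B + mallowsProb n q C := by
  have hZ := Zpos n q hq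
  unfold mallowsProb
  rw [← add_div, ← add_div, le_div_iff₀ hZ, one_mul, ← Finset.sum_add_distrib,
    ← Finset.sum_add_distrib]
  apply Finset.sum_le_sum
  intro π _
  have hp : 0 ≤ q ^ inversions π := by positivity
  have nn : ∀ S : Set (Equiv.Perm (Fin n)), 0 ≤ S.indicator (fun π => q ^ inversions π) π :=
    fun S => Set.indicator_nonneg (fun π _ => by positivity) π
  have a := nn A
  have b := nn B
  have c := nn C
  rcases h π with hh | hh | hh
  · have := Set.indicator_of_mem hh (fun π => q ^ inversions π); linarith
  · have := Set.indicator_of_mem hh (fun π => q ^ inversions π); linarith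
  · have := Set.indicator_of_mem hh (fun π => q ^ inversions π); linarith

/-! ### Asymptotics -/

theorem min_tendsto (q : ℕ → ℝ) (hq : ∀ n, 0 < q n) (β : ℝ)
    (hβ : Tendsto (fun n : ℕ => (n : ℝ) * (1 - q n)) atTop (nhds β)) :
    Tendsto (fun n => (min (q n) (q n)⁻¹) ^ n) atTop (nhds (Real.exp (-|β|))) := by
  have h1 : Tendsto (fun n : ℕ => (1 + (q n - 1)) ^ n) atTop (nhds (Real.exp (-β))) := by
    apply Real.tendsto_one_add_pow_exp_of_tendsto
    refine hβ.neg.congr fun n => by ring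
  have h2 : Tendsto (fun n : ℕ => (q n) ^ n) atTop (nhds (Real.exp (-β))) :=
    h1.congr fun n => by ring_nf
  have h3 := h2.min (h2.inv₀ (Real.exp_pos _).ne')
  have e : min (Real.exp (-β)) (Real.exp (-β))⁻¹ = Real.exp (-|β|) := by
    rw [← Real.exp_neg, neg_neg]
    rcases le_total 0 β with h | h
    · rw [abs_of_nonneg h, min_eq_left]; apply Real.exp_le_exp.2; linarith
    · rw [abs_of_nonpos h, neg_neg, min_eq_right]; apply Real.exp_le_exp.2; linarith
  rw [e] at h3
  refine h3.congr fun n => ?_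
  rcases le_total (q n) (q n)⁻¹ with h | h
  · rw [min_eq_left h, min_eq_left]
    rw [← inv_pow]; exact pow_le_pow_left₀ (hq n).le h n
  · rw [min_eq_right h, min_eq_right, inv_pow]
    rw [← inv_pow]; exact pow_le_pow_left₀ (inv_pos.2 (hq n)).le h n

set_option maxHeartbeats 1000000 in
theorem up_bound (q : ℕ → ℝ) (hq : ∀ n, 0 < q n) (c0 : ℝ) (hc0 : 0 < c0)
    (hc : Tendsto (fun n => (min (q n) (q n)⁻¹) ^ n) atTop (nhds c0)) (κ : ℝ)
    (hκ : 2 / √c0 < κ) (η : ℝ) (hη : 0 < η) :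
    ∀ᶠ n : ℕ in atTop, mallowsProb n (q n) {π | κ * √n ≤ (lisLength π : ℝ)} ≤ η := by
  -- choice of the slack
  obtain ⟨g, hg, hgκ⟩ : ∃ g : ℝ, 1 < g ∧ 2 * g * √(g * (g / c0)) < κ := by
    have hcont : Continuous fun g : ℝ => 2 * g * √(g * (g / c0)) := by fun_prop
    have h1 : (fun g : ℝ => 2 * g * √(g * (g / c0))) 1 < κ := by
      simp only [mul_one, one_mul]
      rw [Real.sqrt_div zero_le_one, Real.sqrt_one, mul_one_div]
      exact hκ
    have h2 := hcont.continuousAt.eventually (eventually_lt_nhds h1)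
    have h3 := h2.filter_mono (nhdsWithin_le_nhds (s := Set.Ioi 1))
    obtain ⟨g, hg1, hg2⟩ := (h3.and self_mem_nhdsWithin).exists
    exact ⟨g, hg2, hg1⟩
  have hg0 : 0 < g := by linarith
  obtain ⟨L, hL, hU⟩ := upper_U (2 * (g - 1)) (η / 8) (by linarith) (by positivity)
  set c : ℕ → ℝ := fun n => (min (q n) (q n)⁻¹) ^ n with hcdef
  set N : ℕ → ℕ := fun n => ⌈g * n / c n⌉₊ with hN
  have hcpos : ∀ n, 0 < c n := fun n => pow_pos (lt_min (hq n) (inv_pos.2 (hq n))) n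
  have hNn : Tendsto (fun n : ℕ => (N n : ℝ) / n) atTop (nhds (g / c0)) := by
    have t1 : Tendsto (fun n => g / c n) atTop (nhds (g / c0)) := tendsto_const_nhds.div hc hc0.ne'
    have t2 : Tendsto (fun n : ℕ => g / c n + 1 / (n : ℝ)) atTop (nhds (g / c0)) := by
      simpa using t1.add tendsto_one_div_atTop_nhds_zero_nat
    refine tendsto_of_tendsto_of_tendsto_of_le_of_le' t1 t2 ?_ ?_
    · filter_upwards [eventually_gt_atTop 0] with n hn
      have hn' : (0 : ℝ) < n := by exact_mod_cast hn
      rw [le_div_iff₀ hn']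
      calc _ = g * n / c n := by ring
        _ ≤ _ := Nat.le_ceil _
    · filter_upwards [eventually_gt_atTop 0] with n hn
      have hn' : (0 : ℝ) < n := by exact_mod_cast hn
      rw [div_le_iff₀ hn', add_mul, one_div, inv_mul_cancel₀ hn'.ne']
      calc _ ≤ g * n / c n + 1 := (Nat.ceil_lt_add_one (by have := hcpos n; positivity)).le
        _ = _ := by ring
  have hs : Tendsto (fun n : ℕ => 2 * g * √(g * ((N n : ℝ) / n))) atTop
      (nhds (2 * g * √(g * (g / c0)))) := ((hNn.const_mul g).sqrt).const_mul (2 * g)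
  have hpow : Tendsto (fun n : ℕ => chU g ^ n) atTop (nhds 0) :=
    tendsto_pow_atTop_nhds_zero_of_lt_one (chU_mem hg).1 (chU_mem hg).2
  filter_upwards [hs.eventually (eventually_lt_nhds hgκ), eventually_gt_atTop 0,
    hpow.eventually (eventually_lt_nhds (show (0 : ℝ) < 1 / 2 by norm_num)),
    eventually_ge_atTop ⌈L⌉₊] with n h1 hn h2 h3
  have hn' : (0 : ℝ) < n := by exact_mod_cast hn
  obtain ⟨c0', c1'⟩ := minq (q n) (hq n) n
  have hNc : g * n ≤ c n * N n := by
    have := Nat.le_ceil (g * n / c n)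
    rw [div_le_iff₀ (hcpos n)] at this
    rw [mul_comm (c n)]; exact this
  have hNge : (n : ℝ) ≤ N n := by
    have : (N n : ℝ) ≥ c n * N n := by
      have : (0 : ℝ) ≤ N n := by positivity
      nlinarith [hcpos n]
    nlinarith
  have hlL : L ≤ g * N n := by
    have : L ≤ n := (Nat.le_ceil L).trans (by exact_mod_cast h3)
    nlinarith
  obtain ⟨M, hM1, hM2, hM3⟩ := ((hU _ hlL).and ((mallows_le n (q n) (hq n)).and
    (eventually_gt_atTop 0))).exists
  have hl : 0 ≤ g * N n := by positivity
  have p0 := pm_nonneg hl M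
  have p1 := pm_le_one (g * N n) M
  have hcore := core_up n M (N n) (q n) (g * N n) g⁻¹ (hq n) hM3
    (fun a => (2 + 2 * (g - 1)) * √(g * N n) ≤ (a : ℝ))
    (fun a b hab ha => ha.trans (by exact_mod_cast hab)) p0 p1 hl (inv_pos.2 hg0)
    (inv_le_one_of_one_le₀ hg.le)
    (hM2 (fun a => (2 + 2 * (g - 1)) * √(g * N n) ≤ (a : ℝ)))
    ((bin_ch hg c0' c1' (N n) n hNc).trans h2.le) (by
      rw [ch_up hg]
      refine le_trans ?_ h2.le
      exact pow_le_pow_of_le_one (chU_mem hg).1 (chU_mem hg).2.le (by exact_mod_cast hNge))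
  have hfin := hM1 p0 p1
  refine (mp_mono n (q n) (hq n) ?_).trans (hcore.trans (by linarith))
  intro π hπ
  simp only [Set.mem_ofPred_eq] at hπ ⊢
  push_cast
  refine le_trans ?_ hπ
  calc (2 + 2 * (g - 1)) * √(g * N n) = (2 * g * √(g * ((N n : ℝ) / n))) * √n := by
        rw [mul_assoc _ _ (√(n : ℝ)), ← Real.sqrt_mul (by positivity)]
        congr 2
        · ring
        · field_simp
    _ ≤ _ := by gcongr

set_option maxHeartbeats 1000000 in
theorem low_bound (q : ℕ → ℝ) (hq : ∀ n, 0 < q n) (c0 : ℝ) (hc0 : 0 < c0)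
    (hc : Tendsto (fun n => (min (q n) (q n)⁻¹) ^ n) atTop (nhds c0)) (κ : ℝ)
    (hκ : κ < 2 * √c0) (η : ℝ) (hη : 0 < η) :
    ∀ᶠ n : ℕ in atTop, mallowsProb n (q n) {π | (lisLength π : ℝ) ≤ κ * √n} ≤ η := by
  obtain ⟨g, hg, hgκ⟩ : ∃ g : ℝ, 1 < g ∧ κ < (2 - 2 * (g - 1)) * √(c0 / g / g) := by
    have h1 : κ < (fun g : ℝ => (2 - 2 * (g - 1)) * √(c0 / g / g)) 1 := by
      simpa using hκ
    have hcont : ContinuousAt (fun g : ℝ => (2 - 2 * (g - 1)) * √(c0 / g / g)) 1 := by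
      have : ContinuousAt (fun g : ℝ => c0 / g / g) 1 :=
        ((continuousAt_const.div continuousAt_id one_ne_zero).div continuousAt_id one_ne_zero)
      exact ContinuousAt.mul (by fun_prop) this.sqrt
    have h2 := hcont.eventually (eventually_gt_nhds h1)
    have h3 := h2.filter_mono (nhdsWithin_le_nhds (s := Set.Ioi 1))
    obtain ⟨g, hg1, hg2⟩ := (h3.and self_mem_nhdsWithin).exists
    exact ⟨g, hg2, hg1⟩
  have hg0 : 0 < g := by linarith
  obtain ⟨L, hL, hU⟩ := lower_U (2 * (g - 1)) (η / 8) (by linarith) (by positivity)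
  set c : ℕ → ℝ := fun n => (min (q n) (q n)⁻¹) ^ n with hcdef
  set K : ℕ → ℕ := fun n => ⌊c n * n / g⌋₊ with hK
  have hcpos : ∀ n, 0 < c n := fun n => pow_pos (lt_min (hq n) (inv_pos.2 (hq n))) n
  have hKn : Tendsto (fun n : ℕ => (K n : ℝ) / n) atTop (nhds (c0 / g)) := by
    have t1 : Tendsto (fun n => c n / g) atTop (nhds (c0 / g)) := hc.div_const g
    have t2 : Tendsto (fun n : ℕ => c n / g - 1 / (n : ℝ)) atTop (nhds (c0 / g)) := by
      simpa using t1.sub tendsto_one_div_atTop_nhds_zero_nat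
    refine tendsto_of_tendsto_of_tendsto_of_le_of_le' t2 t1 ?_ ?_
    · filter_upwards [eventually_gt_atTop 0] with n hn
      have hn' : (0 : ℝ) < n := by exact_mod_cast hn
      rw [le_div_iff₀ hn', sub_mul, one_div, inv_mul_cancel₀ hn'.ne']
      calc _ = c n * n / g - 1 := by ring
        _ ≤ _ := (Nat.sub_one_lt_floor _).le
    · filter_upwards [eventually_gt_atTop 0] with n hn
      have hn' : (0 : ℝ) < n := by exact_mod_cast hn
      rw [div_le_iff₀ hn']
      calc _ ≤ c n * n / g := Nat.floor_le (by have := hcpos n; positivity)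
        _ = _ := by ring
  have hKtop : Tendsto (fun n : ℕ => (K n : ℝ)) atTop atTop := by
    have := hKn.pos_mul_atTop (by positivity : 0 < c0 / g) (tendsto_natCast_atTop_atTop (R := ℝ))
    refine this.congr' ?_
    filter_upwards [eventually_gt_atTop 0] with n hn
    have hn' : (0 : ℝ) < n := by exact_mod_cast hn
    field_simp
  have hKtop' : Tendsto K atTop atTop := tendsto_natCast_atTop_iff.1 hKtop
  have hs : Tendsto (fun n : ℕ => (2 - 2 * (g - 1)) * √((K n : ℝ) / n / g)) atTop
      (nhds ((2 - 2 * (g - 1)) * √(c0 / g / g))) := ((hKn.div_const g).sqrt).const_mul _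
  have hpow : Tendsto (fun n : ℕ => chU g ^ K n) atTop (nhds 0) :=
    (tendsto_pow_atTop_nhds_zero_of_lt_one (chU_mem hg).1 (chU_mem hg).2).comp hKtop'
  have hpow' : Tendsto (fun n : ℕ => chL g ^ K n) atTop (nhds 0) :=
    (tendsto_pow_atTop_nhds_zero_of_lt_one (chL_mem hg).1 (chL_mem hg).2).comp hKtop'
  filter_upwards [hs.eventually (eventually_gt_nhds hgκ), eventually_gt_atTop 0,
    hpow.eventually (eventually_lt_nhds (show (0 : ℝ) < η / 4 by positivity)),
    hpow'.eventually (eventually_lt_nhds (show (0 : ℝ) < 1 / 2 by norm_num)),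
    hKtop.eventually_ge_atTop (L * g)] with n h1 hn h2 h2' h3
  have hn' : (0 : ℝ) < n := by exact_mod_cast hn
  obtain ⟨c0', c1'⟩ := minq (q n) (hq n) n
  have hKc : g * K n ≤ c n * n := by
    have := Nat.floor_le (show 0 ≤ c n * n / g by have := hcpos n; positivity)
    rw [le_div_iff₀ hg0] at this
    rw [mul_comm g]; exact this
  have hlL : L ≤ K n / g := by rw [le_div_iff₀ hg0]; exact h3
  obtain ⟨M, hM1, hM2, hM3⟩ := ((hU _ hlL).and ((mallows_le n (q n) (hq n)).and
    (eventually_gt_atTop 0))).exists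
  have hl : 0 ≤ K n / g := by positivity
  have p0 := pm_nonneg hl M
  have p1 := pm_le_one (K n / g) M
  have hcore := core_low n M (K n) (q n) (K n / g) g (hq n) hM3
    (fun a => (a : ℝ) ≤ (2 - 2 * (g - 1)) * √(K n / g))
    (fun a b hab ha => le_trans (by exact_mod_cast hab) ha) p0 p1 hl hg.le
    (hM2 (fun a => (a : ℝ) ≤ (2 - 2 * (g - 1)) * √(K n / g))) (by
      rw [ch_low hg]; exact h2'.le)
  have hfin := hM1 p0 p1
  have hbin := bin_ch hg c0' c1' n (K n) hKc
  refine (mp_mono n (q n) (hq n) ?_).trans (hcore.trans (by linarith))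
  intro π hπ
  simp only [Set.mem_ofPred_eq] at hπ ⊢
  push_cast
  refine le_trans hπ ?_
  calc κ * √n ≤ ((2 - 2 * (g - 1)) * √((K n : ℝ) / n / g)) * √n := by gcongr
    _ = _ := by
        rw [mul_assoc, ← Real.sqrt_mul (by positivity)]
        congr 2
        field_simp

/-- A priori bounds: with probability tending to one, the rescaled length of the longest
increasing subsequence of a Mallows(n,qₙ) random permutation lies in
`(2e^{-|β|/2} - ε, 2e^{|β|/2} + ε)`. -/
theorem mallows_lis_exponential_bounds (q : ℕ → ℝ) (hq : ∀ n, 0 < q n) (β : ℝ)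
    (hβ : Tendsto (fun n : ℕ => (n : ℝ) * (1 - q n)) atTop (nhds β)) :
    ∀ ε > 0, Tendsto (fun n : ℕ =>
        mallowsProb n (q n)
          {π | (lisLength π : ℝ) / Real.sqrt n ∈
            Set.Ioo (2 * Real.exp (-|β| / 2) - ε) (2 * Real.exp (|β| / 2) + ε)})
      atTop (nhds 1) := by
  intro ε hε
  have hc := min_tendsto q hq β hβ
  have hsq : √(Real.exp (-|β|)) = Real.exp (-|β| / 2) := (Real.exp_half _).symm
  have hu := up_bound q hq _ (Real.exp_pos _) hc (2 * Real.exp (|β| / 2) + ε) (by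
    rw [hsq, neg_div, Real.exp_neg, div_inv_eq_mul]; linarith)
  have hl := low_bound q hq _ (Real.exp_pos _) hc (2 * Real.exp (-|β| / 2) - ε) (by
    rw [hsq]; linarith)
  rw [tendsto_order]
  constructor
  · intro a ha
    have hη : 0 < (1 - a) / 4 := by linarith
    filter_upwards [hu _ hη, hl _ hη, eventually_gt_atTop 0] with n h1 h2 hn
    have hn' : (0 : ℝ) < √(n : ℝ) := Real.sqrt_pos.2 (by exact_mod_cast hn)
    have := mp_cover n (q n) (hq n)
      {π | (lisLength π : ℝ) / Real.sqrt n ∈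
            Set.Ioo (2 * Real.exp (-|β| / 2) - ε) (2 * Real.exp (|β| / 2) + ε)}
      {π | (2 * Real.exp (|β| / 2) + ε) * √n ≤ (lisLength π : ℝ)}
      {π | (lisLength π : ℝ) ≤ (2 * Real.exp (-|β| / 2) - ε) * √n} (by
        intro π
        simp only [Set.mem_ofPred_eq, Set.mem_Ioo]
        rw [lt_div_iff₀ hn', div_lt_iff₀ hn']
        by_contra hcon
        push Not at hcon
        obtain ⟨x, y, z⟩ := hcon
        exact absurd (x z) (not_le.2 y))
    linarith
  · intro a ha
    filter_upwards with n
    refine lt_of_le_of_lt ?_ ha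
    rw [← mp_univ n (q n) (hq n)]
    exact mp_mono n (q n) (hq n) (Set.subset_univ _)
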